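/- arXiv:2007.08831 — 8 statements merged into one kernel-verified Lean document; each statement's English description precedes it below -/
import Mathlib

section
/- Let R be an integral domain and let p, q ∈ R. The 2×2 matrix [[p, q], [0, 0]] is a product of idempotent matrices in M₂(R) if and only if the matrix [[q, p], [0, 0]] is a product of idempotent matrices in M₂(R). -/
/-- A `2 × 2` matrix is a product of idempotent matrices if it is the product of a
finite list of idempotent matrices. -/
def IsProductOfIdempotents {R : Type*} [CommRing R] (A : Matrix (Fin 2) (Fin 2) R) : Prop :=
  ∃ L : List (Matrix (Fin 2) (Fin 2) R), (∀ T ∈ L, IsIdempotentElem T) ∧ L.prod = A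

theorem IsProductOfIdempotents.idempotent_mul {R : Type*} [CommRing R]
    {E A : Matrix (Fin 2) (Fin 2) R} (hE : IsIdempotentElem E) (hA : IsProductOfIdempotents A) :
    IsProductOfIdempotents (E * A) := by
  obtain ⟨L, hL, rfl⟩ := hA
  exact ⟨E :: L, List.forall_mem_cons.2 ⟨hE, hL⟩, List.prod_cons⟩

theorem IsProductOfIdempotents.reindex {R : Type*} [CommRing R]
    {A : Matrix (Fin 2) (Fin 2) R} (hA : IsProductOfIdempotents A) (e : Fin 2 ≃ Fin 2) :
    IsProductOfIdempotents (Matrix.reindex e e A) := by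
  obtain ⟨L, hL, rfl⟩ := hA
  refine ⟨L.map (Matrix.reindexAlgEquiv R R e), ?_, (map_list_prod _ L).symm⟩
  intro T hT
  obtain ⟨U, hU, rfl⟩ := List.mem_map.1 hT
  exact (hL U hU).map _

theorem IsProductOfIdempotents.swap_row {R : Type*} [CommRing R] {p q : R}
    (h : IsProductOfIdempotents !![p, q; 0, 0]) : IsProductOfIdempotents !![q, p; 0, 0] := by
  have hE : IsIdempotentElem (!![1, 1; 0, 0] : Matrix (Fin 2) (Fin 2) R) := by
    rw [IsIdempotentElem]
    ext i j
    fin_cases i <;> fin_cases j <;> simp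
  have hS : Matrix.reindex (Equiv.swap 0 1) (Equiv.swap 0 1) !![p, q; 0, 0] = !![0, 0; q, p] := by
    ext i j
    fin_cases i <;> fin_cases j <;> simp
  have hM : !![1, 1; 0, 0] * !![0, 0; q, p] = !![q, p; 0, 0] := by
    ext i j
    fin_cases i <;> fin_cases j <;> simp
  exact hM ▸ (hS ▸ h.reindex (Equiv.swap 0 1)).idempotent_mul hE

theorem stmt_0 {R : Type*} [CommRing R] [IsDomain R] (p q : R) :
    IsProductOfIdempotents (!![p, q; 0, 0] : Matrix (Fin 2) (Fin 2) R) ↔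
      IsProductOfIdempotents (!![q, p; 0, 0] : Matrix (Fin 2) (Fin 2) R) :=
  ⟨IsProductOfIdempotents.swap_row, IsProductOfIdempotents.swap_row⟩
end

section
/- Let R be an integral domain, let p and q be nonzero elements of R, and let M = [[p, q], [0, 0]] ∈ M₂(R). Suppose M = S·T where S = [[p', q'], [z, t]] ∈ M₂(R) has determinant 0 and T = [[a, b], [c, 1−a]] ∈ M₂(R) is idempotent. Then z = 0 and t = 0, i.e., S = [[p', q'], [0, 0]]. -/
theorem stmt_1 {R : Type*} [CommRing R] [IsDomain R]
    (p q p' q' z t a b c : R) (hp : p ≠ 0) (hq : q ≠ 0)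
    (hSdet : (!![p', q'; z, t] : Matrix (Fin 2) (Fin 2) R).det = 0)
    (hT : IsIdempotentElem (!![a, b; c, 1 - a] : Matrix (Fin 2) (Fin 2) R))
    (hM : (!![p, q; 0, 0] : Matrix (Fin 2) (Fin 2) R) =
      !![p', q'; z, t] * !![a, b; c, 1 - a]) :
    z = 0 ∧ t = 0 := by
  have hdet : p' * t - q' * z = 0 := by simpa [Matrix.det_fin_two] using hSdet
  have h00 : p = p' * a + q' * c := by simpa using congrFun (congrFun hM 0) 0
  have h10 : 0 = z * a + t * c := by simpa using congrFun (congrFun hM 1) 0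
  have hz : z * p = 0 := by linear_combination z * h00 - p' * h10 - c * hdet
  have ht : t * p = 0 := by linear_combination t * h00 - q' * h10 + a * hdet
  exact ⟨(mul_eq_zero.mp hz).resolve_right hp, (mul_eq_zero.mp ht).resolve_right hp⟩
end

section
/- Let x and y be nonzero polynomials in ℝ[X] with deg x = deg y. Suppose that y(u) > 0 for every real root u of x, or that y(u) < 0 for every real root u of x. Then there exists β ∈ ℝ[X] with no real roots such that the polynomial δ = x² + y·β satisfies δ(t) > 0 for every t ∈ ℝ, deg x − 1 ≤ deg β ≤ deg x, and deg δ = 2·deg x. -/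
open Polynomial

open Filter Asymptotics in
/-- If `q` has degree at most that of `p` and `p` is nonzero, then `q` is eventually dominated
by a multiple of `p` at both ends of the real line. -/
lemma isBigO_cocompact_of_natDegree_le {p q : ℝ[X]} (hp : p ≠ 0)
    (h : q.natDegree ≤ p.natDegree) :
    (fun t => q.eval t) =O[cocompact ℝ] fun t => p.eval t := by
  have h' : q.degree ≤ p.degree := degree_le_natDegree.trans <| by
    rw [degree_eq_natDegree hp]
    exact_mod_cast h
  rw [cocompact_eq_atBot_atTop, isBigO_sup]
  exact ⟨q.isBigO_atBot_of_degree_le p h', q.isBigO_atTop_of_degree_le p h'⟩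

open Filter Topology in
/-- If `q` is positive at the real roots of `x` and `deg q ≤ deg (x ^ 2)`, then `q + C * x ^ 2` is
positive everywhere for all large `C`. -/
lemma exists_forall_ge_eval_add_mul_sq_pos {x q : ℝ[X]} (hx : x ≠ 0)
    (hdeg : q.natDegree ≤ (x ^ 2).natDegree) (hpos : ∀ u, x.eval u = 0 → 0 < q.eval u) :
    ∃ C : ℝ, ∀ D ≥ C, ∀ t, 0 < q.eval t + D * x.eval t ^ 2 := by
  obtain ⟨c, hc⟩ := (isBigO_cocompact_of_natDegree_le (pow_ne_zero 2 hx) hdeg).bound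
  obtain ⟨K, hK, hKc⟩ := mem_cocompact.1 hc
  have hout : ∀ t ∉ K, |q.eval t| ≤ c * x.eval t ^ 2 := by
    intro t ht
    simpa using hKc ht
  have hin : ∃ C : ℝ, ∀ D ≥ C, ∀ t ∈ K, 0 < q.eval t + D * x.eval t ^ 2 := by
    refine hK.induction_on (p := fun s => ∃ C : ℝ, ∀ D ≥ C, ∀ t ∈ s,
      0 < q.eval t + D * x.eval t ^ 2) ?_ ?_ ?_ ?_
    · simp
    · rintro s t hst ⟨C, hC⟩
      exact ⟨C, fun D hD u hu => hC D hD u (hst hu)⟩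
    · rintro s t ⟨C, hC⟩ ⟨C', hC'⟩
      refine ⟨max C C', fun D hD u hu => ?_⟩
      rcases hu with hu | hu
      · exact hC D (le_of_max_le_left hD) u hu
      · exact hC' D (le_of_max_le_right hD) u hu
    · intro u _
      obtain ⟨C, hC⟩ : ∃ C : ℝ, 0 < q.eval u + C * x.eval u ^ 2 := by
        by_cases hu : x.eval u = 0
        · exact ⟨0, by simpa using hpos u hu⟩
        · refine ⟨(1 - q.eval u) / x.eval u ^ 2, ?_⟩
          rw [div_mul_cancel₀ _ (pow_ne_zero 2 hu)]
          linarith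
      have hcont : Continuous fun t => q.eval t + C * x.eval t ^ 2 := by fun_prop
      refine ⟨_, mem_nhdsWithin_of_mem_nhds (hcont.continuousAt.eventually_const_lt hC), C,
        fun D hD t ht => ?_⟩
      have ht' : 0 < q.eval t + C * x.eval t ^ 2 := ht
      nlinarith [mul_le_mul_of_nonneg_right hD (sq_nonneg (x.eval t))]
  obtain ⟨C, hC⟩ := hin
  refine ⟨max C (c + 1), fun D hD t => ?_⟩
  by_cases ht : t ∈ K
  · exact hC D (le_of_max_le_left hD) t ht
  · have h1 := mul_le_mul_of_nonneg_right (le_of_max_le_right hD) (sq_nonneg (x.eval t))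
    have h2 := neg_le_of_abs_le (hout t ht)
    by_cases hxt : x.eval t = 0
    · simpa [hxt] using hpos t hxt
    · have := pow_pos (abs_pos.2 hxt) 2
      rw [sq_abs] at this
      linarith

lemma exists_rootless_cofactor_of_pos_at_roots {x y : ℝ[X]} (hx : x ≠ 0)
    (hdeg : x.natDegree = y.natDegree) (hpos : ∀ u, x.eval u = 0 → 0 < y.eval u) :
    ∃ β : ℝ[X], (∀ u, β.eval u ≠ 0) ∧ (∀ t, 0 < (x ^ 2 + y * β).eval t) ∧
      x.natDegree - 1 ≤ β.natDegree ∧ β.natDegree ≤ x.natDegree ∧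
      (x ^ 2 + y * β).natDegree = 2 * x.natDegree := by
  set n := x.natDegree with hn
  set b : ℝ[X] := (X ^ 2 + C 1) ^ (n / 2) with hb
  have hbdeg : b.natDegree = n / 2 * 2 := by
    rw [hb, natDegree_pow, natDegree_X_pow_add_C]
  have hbpos : ∀ u, 0 < b.eval u := fun u => by
    simp only [hb, eval_pow, eval_add, eval_X, eval_C]
    positivity
  have hx2 : (x ^ 2).natDegree = 2 * n := natDegree_pow x 2
  have hqdeg : (y * b).natDegree ≤ 2 * n := natDegree_mul_le.trans (by omega)
  obtain ⟨c, hc⟩ := exists_forall_ge_eval_add_mul_sq_pos hx (hx2 ▸ hqdeg)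
    (fun u hu => by simpa using mul_pos (hpos u hu) (hbpos u))
  have ha : 0 < x.leadingCoeff ^ 2 := by
    have := leadingCoeff_ne_zero.2 hx
    positivity
  set r := (y * b).coeff (2 * n) with hr
  set D := max c (|r| / x.leadingCoeff ^ 2 + 1) with hD
  have hDr : |r| < D * x.leadingCoeff ^ 2 := by
    rw [← div_lt_iff₀ ha]
    exact (lt_add_one _).trans_le (le_max_right _ _)
  have hDpos : 0 < D := lt_of_lt_of_le (by positivity) (le_max_right _ _)
  have hD0 : D⁻¹ ≠ 0 := (inv_pos.2 hDpos).ne'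
  have hdeg' : (C D⁻¹ * b).natDegree = n / 2 * 2 := by rw [natDegree_C_mul hD0, hbdeg]
  have hδ : x ^ 2 + y * (C D⁻¹ * b) = C D⁻¹ * (y * b + C D * x ^ 2) := by
    have : (C D⁻¹ * C D : ℝ[X]) = 1 := by rw [← C_mul, inv_mul_cancel₀ hDpos.ne', C_1]
    linear_combination (-x ^ 2) * this
  refine ⟨C D⁻¹ * b, fun u => ?_, fun t => ?_, by omega, by omega, ?_⟩
  · simpa using ⟨hDpos.ne', (hbpos u).ne'⟩
  · rw [hδ]
    have := mul_pos (inv_pos.2 hDpos) (hc D (le_max_left _ _) t)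
    simpa using this
  · rw [hδ, natDegree_C_mul hD0]
    refine natDegree_eq_of_le_of_coeff_ne_zero
      (natDegree_add_le_of_degree_le hqdeg ((natDegree_C_mul_le _ _).trans hx2.le)) ?_
    have hcoeff : (x ^ 2).coeff (2 * n) = x.leadingCoeff ^ 2 := by
      rw [← hx2, coeff_natDegree, leadingCoeff_pow]
    rw [coeff_add, coeff_C_mul, hcoeff, ← hr]
    have : 0 < r + D * x.leadingCoeff ^ 2 := by linarith [neg_abs_le r]
    exact this.ne'

theorem stmt_2 (x y : Polynomial ℝ) (hx : x ≠ 0) (hy : y ≠ 0)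
    (hdeg : x.natDegree = y.natDegree)
    (hsign : (∀ u : ℝ, x.eval u = 0 → 0 < y.eval u) ∨
             (∀ u : ℝ, x.eval u = 0 → y.eval u < 0)) :
    ∃ β : Polynomial ℝ, (∀ u : ℝ, β.eval u ≠ 0) ∧
      (∀ t : ℝ, 0 < (x ^ 2 + y * β).eval t) ∧
      x.natDegree - 1 ≤ β.natDegree ∧ β.natDegree ≤ x.natDegree ∧
      (x ^ 2 + y * β).natDegree = 2 * x.natDegree := by
  rcases hsign with h | h
  · exact exists_rootless_cofactor_of_pos_at_roots hx hdeg h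
  · obtain ⟨β, h1, h2, h3, h4, h5⟩ := exists_rootless_cofactor_of_pos_at_roots (y := -y) hx
      (by rwa [natDegree_neg]) (fun u hu => by simpa using h u hu)
    rw [neg_mul_comm] at h2 h5
    exact ⟨-β, fun u => by simpa using h1 u, h2, by rwa [natDegree_neg], by rwa [natDegree_neg], h5⟩
end

section
/- Let x and y be nonzero polynomials in ℝ[X] with deg x = deg y. Suppose that x(z) > 0 for every real root z of y, or that x(z) < 0 for every real root z of y. Then there exists η ∈ ℝ[X] with no real roots such that the polynomial δ = x·η + y² satisfies δ(t) > 0 for every t ∈ ℝ, deg y − 1 ≤ deg η ≤ deg y, and deg δ = 2·deg y. -/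
open Polynomial

/-- If `deg p ≤ deg q`, then `|p|` is bounded by a multiple of `|q|` outside a compact
interval. -/
lemma exists_abs_eval_le_mul_abs_eval (p q : ℝ[X]) (h : p.degree ≤ q.degree) :
    ∃ C R : ℝ, ∀ t : ℝ, R < |t| → |p.eval t| ≤ C * |q.eval t| := by
  obtain ⟨C, hC⟩ := (isBigO_cobounded_of_degree_le h).bound
  obtain ⟨R, -, hR⟩ := (Filter.hasBasis_cobounded_norm (E := ℝ)).eventually_iff.1 hC
  exact ⟨C, R, fun t ht => by simpa only [Real.norm_eq_abs] using hR (x := t) ht.le⟩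

/-- If `w` is a positive polynomial with `deg w ≤ deg y` and `x` is positive at the roots of `y`,
then a small positive multiple of `x * w` can be added to `y ^ 2` to give a positive polynomial of
degree `2 * deg y`. -/
lemma exists_pos_mul_add_sq_pos (x y w : ℝ[X]) (hy : y ≠ 0)
    (hdeg : x.natDegree = y.natDegree) (hw : ∀ t : ℝ, 0 < w.eval t)
    (hwdeg : w.natDegree ≤ y.natDegree)
    (hsign : ∀ z : ℝ, y.eval z = 0 → 0 < x.eval z) :
    ∃ ε : ℝ, 0 < ε ∧ (∀ t : ℝ, 0 < (x * (C ε * w) + y ^ 2).eval t) ∧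
      (x * (C ε * w) + y ^ 2).natDegree = 2 * y.natDegree := by
  have hxw : (x * w).natDegree ≤ 2 * y.natDegree := natDegree_mul_le.trans (by omega)
  have hy2 : (y ^ 2).natDegree = 2 * y.natDegree := natDegree_pow y 2
  have hle : (x * w).degree ≤ (y ^ 2).degree := by
    rw [degree_eq_natDegree (pow_ne_zero 2 hy), hy2]
    exact natDegree_le_iff_degree_le.1 hxw
  obtain ⟨A, R, hA⟩ := exists_abs_eval_le_mul_abs_eval (x * w) (y ^ 2) hle
  have hK : IsCompact (Set.Icc (-R) R ∩ {t : ℝ | x.eval t ≤ 0}) :=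
    isCompact_Icc.inter_right (isClosed_le x.continuous continuous_const)
  obtain ⟨B, hB⟩ := hK.exists_bound_of_continuousOn
    (f := fun t => (x * w).eval t / (y ^ 2).eval t) <| by
      refine (x * w).continuous.continuousOn.div (y ^ 2).continuous.continuousOn ?_
      rintro t ⟨-, ht⟩ h0
      have := hsign t (by simpa using h0)
      exact absurd ht (not_le.2 this)
  have hlc : 0 < y.leadingCoeff ^ 2 := by
    have := leadingCoeff_ne_zero.2 hy
    positivity
  set c := (x * w).coeff (2 * y.natDegree) with hc
  set D := max (max A B) (|c| / y.leadingCoeff ^ 2) with hD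
  have hD0 : 0 ≤ D := le_max_of_le_right (by positivity)
  have hεpos : 0 < 1 / (1 + D) := by positivity
  have hεD : 1 / (1 + D) * D < 1 := by
    rw [one_div_mul_eq_div, div_lt_one (by positivity)]
    linarith
  set ε := 1 / (1 + D)
  have pos_of_le {a b : ℝ} (hb : 0 < b) (hab : |a| ≤ D * b) : 0 < ε * a + b := by
    have h₁ : ε * -a ≤ ε * (D * b) := by
      gcongr
      exact (neg_le_abs a).trans hab
    nlinarith
  refine ⟨ε, hεpos, fun t => ?_, ?_⟩
  · have he : (x * (C ε * w) + y ^ 2).eval t = ε * (x * w).eval t + (y ^ 2).eval t := by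
      simp only [eval_add, eval_mul, eval_C]
      ring
    rw [he]
    have hsq : 0 ≤ (y ^ 2).eval t := by
      rw [eval_pow]
      positivity
    by_cases hxt : 0 < x.eval t
    · have : 0 < (x * w).eval t := by
        rw [eval_mul]
        exact mul_pos hxt (hw t)
      positivity
    · have hyt : 0 < (y ^ 2).eval t :=
        hsq.lt_of_ne' fun h => hxt (hsign t (by simpa using h))
      refine pos_of_le hyt ?_
      by_cases ht : R < |t|
      · refine (hA t ht).trans ?_
        rw [abs_of_pos hyt]
        gcongr
        exact (le_max_left A B).trans (le_max_left _ _)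
      · have := hB t ⟨abs_le.1 (not_lt.1 ht), not_lt.1 hxt⟩
        rw [Real.norm_eq_abs, abs_div, abs_of_pos hyt, div_le_iff₀ hyt] at this
        refine this.trans ?_
        gcongr
        exact (le_max_right A B).trans (le_max_left _ _)
  · have he : x * (C ε * w) + y ^ 2 = C ε * (x * w) + y ^ 2 := by ring
    rw [he]
    refine natDegree_eq_of_le_of_coeff_ne_zero
      (natDegree_add_le_of_degree_le ((natDegree_C_mul_le _ _).trans hxw) hy2.le) ?_
    rw [coeff_add, coeff_C_mul, ← hc, ← hy2, coeff_natDegree, leadingCoeff_pow]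
    refine (pos_of_le hlc ?_).ne'
    rw [← div_le_iff₀ hlc]
    exact le_max_right _ _

theorem stmt_3 (x y : Polynomial ℝ) (hx : x ≠ 0) (hy : y ≠ 0)
    (hdeg : x.natDegree = y.natDegree)
    (hsign : (∀ z : ℝ, y.eval z = 0 → 0 < x.eval z) ∨
             (∀ z : ℝ, y.eval z = 0 → x.eval z < 0)) :
    ∃ η : Polynomial ℝ, (∀ u : ℝ, η.eval u ≠ 0) ∧
      (∀ t : ℝ, 0 < (x * η + y ^ 2).eval t) ∧
      y.natDegree - 1 ≤ η.natDegree ∧ η.natDegree ≤ y.natDegree ∧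
      (x * η + y ^ 2).natDegree = 2 * y.natDegree := by
  set w : ℝ[X] := (X ^ 2 + C 1) ^ (y.natDegree / 2) with hwdef
  have hw (t : ℝ) : 0 < w.eval t := by
    simp only [hwdef, eval_pow, eval_add, eval_X, eval_C]
    positivity
  have hwdeg : w.natDegree = y.natDegree / 2 * 2 := by
    rw [hwdef, natDegree_pow, natDegree_X_pow_add_C]
  rcases hsign with h | h
  · obtain ⟨ε, hε, hpos, hd⟩ := exists_pos_mul_add_sq_pos x y w hy hdeg hw (by omega) h
    have hηdeg : (C ε * w).natDegree = w.natDegree := natDegree_C_mul hε.ne'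
    refine ⟨C ε * w, fun u => ?_, hpos, by omega, by omega, hd⟩
    rw [eval_mul, eval_C]
    exact (mul_pos hε (hw u)).ne'
  · obtain ⟨ε, hε, hpos, hd⟩ := exists_pos_mul_add_sq_pos (-x) y w hy (by rwa [natDegree_neg]) hw
      (by omega) (fun z hz => by simpa using h z hz)
    have hηdeg : (-(C ε * w)).natDegree = w.natDegree := by
      rw [natDegree_neg, natDegree_C_mul hε.ne']
    rw [neg_mul_comm] at hd
    simp only [neg_mul_comm x] at hpos
    refine ⟨-(C ε * w), fun u => ?_, hpos, by omega, by omega, hd⟩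
    rw [eval_neg, eval_mul, eval_C]
    exact neg_ne_zero.2 (mul_pos hε (hw u)).ne'
end

section
/- Let p, q ∈ D with deg p ≥ deg q. Suppose that q(u) > 0 for every real root u of p, or that q(u) < 0 for every real root u of p. Then the matrix [[p, q], [0, 0]] ∈ M₂(D) is a product of idempotent matrices over D. -/
/-- The minimal Dress ring of `ℝ(X)`: the smallest subring of `RatFunc ℝ` containing
every element of the form `1/(1+x²)`. -/
noncomputable def DressD : Subring (RatFunc ℝ) :=
  Subring.closure {z : RatFunc ℝ | ∃ x : RatFunc ℝ, z = (1 + x ^ 2)⁻¹}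

/-- Evaluation at a real number of an element of the Dress ring. -/
noncomputable def evalD (p : DressD) (u : ℝ) : ℝ :=
  RatFunc.eval (RingHom.id ℝ) u (p : RatFunc ℝ)

open Polynomial

section Idempotents

variable {R : Type*} [CommRing R]

theorem vec_zero_zero : (![0, 0] : Fin 2 → R) = 0 := by
  ext i
  fin_cases i <;> rfl

theorem IsIdempotentElem.isProductOfIdempotents {A : Matrix (Fin 2) (Fin 2) R}
    (hA : IsIdempotentElem A) : IsProductOfIdempotents A :=
  ⟨[A], by simpa using hA, by simp⟩

theorem IsProductOfIdempotents.mul {A B : Matrix (Fin 2) (Fin 2) R}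
    (hA : IsProductOfIdempotents A) (hB : IsProductOfIdempotents B) :
    IsProductOfIdempotents (A * B) := by
  obtain ⟨L, hL, rfl⟩ := hA
  obtain ⟨K, hK, rfl⟩ := hB
  exact ⟨L ++ K, fun T hT => (List.mem_append.1 hT).elim (hL T) (hK T), by simp⟩

theorem IsProductOfIdempotents.conj {A V U : Matrix (Fin 2) (Fin 2) R} (hVU : V * U = 1)
    (hA : IsProductOfIdempotents A) : IsProductOfIdempotents (V * A * U) := by
  have hUV : U * V = 1 := mul_eq_one_comm.1 hVU
  have key (B C : Matrix (Fin 2) (Fin 2) R) : V * B * U * (V * C * U) = V * (B * C) * U := by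
    calc V * B * U * (V * C * U) = V * B * (U * V) * C * U := by simp only [mul_assoc]
      _ = V * (B * C) * U := by rw [hUV, mul_one]; simp only [mul_assoc]
  obtain ⟨L, hL, rfl⟩ := hA
  refine ⟨L.map fun T => V * T * U, ?_, ?_⟩
  · simp only [List.mem_map, forall_exists_index, and_imp]
    rintro _ T hT rfl
    rw [IsIdempotentElem, key, hL T hT]
  · induction L with
    | nil => simp [hVU]
    | cons T L ih =>
      rw [List.map_cons, List.prod_cons, List.prod_cons,
        ih fun T hT => hL T (List.mem_cons_of_mem _ hT), key]

/-- The row `(p, q)`, completed by a zero row, is a product of idempotent matrices. -/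
def IsIdempotentRow (p q : R) : Prop :=
  IsProductOfIdempotents !![p, q; 0, 0]

theorem IsIdempotentRow.swap {p q : R} (h : IsIdempotentRow p q) : IsIdempotentRow q p := by
  have hconj := h.conj (V := !![0, 1; 1, 0]) (U := !![0, 1; 1, 0])
    (by simp [Matrix.one_fin_two])
  have hsum : IsIdempotentElem (!![1, 1; 0, 0] : Matrix (Fin 2) (Fin 2) R) := by
    simp [IsIdempotentElem, vec_zero_zero]
  simpa [IsIdempotentRow, vec_zero_zero] using hsum.isProductOfIdempotents.mul hconj

theorem IsIdempotentRow.add_mul_right {p q : R} (h : IsIdempotentRow p q) (t : R) :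
    IsIdempotentRow p (q + t * p) := by
  have hconj := h.conj (V := !![1, -t; 0, 1]) (U := !![1, t; 0, 1])
    (by simp [Matrix.one_fin_two])
  simpa [IsIdempotentRow, vec_zero_zero, mul_comm, add_comm] using hconj

theorem IsIdempotentRow.add_mul_left {p q : R} (h : IsIdempotentRow p q) (t : R) :
    IsIdempotentRow (p + t * q) q :=
  (h.swap.add_mul_right t).swap

theorem IsIdempotentRow.neg_right {p q : R} (h : IsIdempotentRow p q) :
    IsIdempotentRow p (-q) := by
  have hconj := h.conj (V := !![1, 0; 0, -1]) (U := !![1, 0; 0, -1])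
    (by simp [Matrix.one_fin_two])
  simpa [IsIdempotentRow, vec_zero_zero] using hconj

theorem isIdempotentRow_zero_left (q : R) : IsIdempotentRow 0 q := by
  have h₁ : IsIdempotentElem !![1, q; 0, 0] := by simp [IsIdempotentElem, vec_zero_zero]
  have h₂ : IsIdempotentElem (!![0, 0; 0, 1] : Matrix (Fin 2) (Fin 2) R) := by
    simp [IsIdempotentElem, vec_zero_zero]
  simpa [IsIdempotentRow, vec_zero_zero] using h₁.isProductOfIdempotents.mul h₂.isProductOfIdempotents

theorem isIdempotentRow_mul_left (t q : R) : IsIdempotentRow (t * q) q := by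
  simpa using (isIdempotentRow_zero_left q).add_mul_left t

theorem IsIdempotentRow.smul {p q : R} (d : R) (h : IsIdempotentRow p q) :
    IsIdempotentRow (d * p) (d * q) := by
  simpa [IsIdempotentRow, vec_zero_zero] using
    (show IsProductOfIdempotents !![d, 0; 0, 0] from (isIdempotentRow_zero_left d).swap).mul h

/-- The bottom row of an idempotent matrix. -/
theorem isIdempotentRow_of_isIdempotentElem {a b c d : R}
    (h : IsIdempotentElem !![a, b; c, d]) : IsIdempotentRow c d := by
  simpa [IsIdempotentRow, vec_zero_zero] using
    (show IsProductOfIdempotents (!![0, 1; 0, 0] : Matrix (Fin 2) (Fin 2) R) from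
      isIdempotentRow_zero_left (1 : R)).mul h.isProductOfIdempotents

end Idempotents

theorem Polynomial.natDegree_le_natDegree_sq_add_sq (a b : ℝ[X]) :
    (b ^ 2).natDegree ≤ (a ^ 2 + b ^ 2).natDegree := by
  rcases eq_or_ne b 0 with rfl | hb
  · simp
  set n := max a.natDegree b.natDegree with hn
  have hcoeff : (a ^ 2 + b ^ 2).coeff (2 * n) = a.coeff n ^ 2 + b.coeff n ^ 2 := by
    rw [coeff_add, coeff_pow_of_natDegree_le (le_max_left _ _),
      coeff_pow_of_natDegree_le (le_max_right _ _)]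
  have hpos : a.coeff n ^ 2 + b.coeff n ^ 2 ≠ 0 := by
    rcases le_total a.natDegree b.natDegree with h | h
    · have : b.coeff n ≠ 0 := by
        rwa [hn, max_eq_right h, coeff_natDegree, leadingCoeff_ne_zero]
      positivity
    · rcases eq_or_ne a 0 with rfl | ha
      · have : b.coeff n ≠ 0 := by
          rwa [hn, natDegree_zero, max_eq_right (Nat.zero_le _), coeff_natDegree,
            leadingCoeff_ne_zero]
        positivity
      have : a.coeff n ≠ 0 := by
        rwa [hn, max_eq_left h, coeff_natDegree, leadingCoeff_ne_zero]
      positivity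
  rw [natDegree_pow]
  exact (Nat.mul_le_mul_left 2 (le_max_right _ _)).trans
    (le_natDegree_of_ne_zero (hcoeff ▸ hpos))

theorem Polynomial.ne_zero_of_forall_eval_ne_zero {γ : ℝ[X]} (hγ : ∀ u, γ.eval u ≠ 0) : γ ≠ 0 :=
  fun h => hγ 0 (by simp [h])

theorem RatFunc.eval_num_sq_add_denom_sq_ne_zero (x : RatFunc ℝ) (u : ℝ) :
    (x.num ^ 2 + x.denom ^ 2).eval u ≠ 0 := by
  obtain ⟨a, b, hab⟩ := x.isCoprime_num_denom
  have hab' := congrArg (Polynomial.eval u) hab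
  simp only [Polynomial.eval_add, Polynomial.eval_mul, eval_pow, Polynomial.eval_one] at hab' ⊢
  intro h0
  have h1 : x.num.eval u = 0 := by
    nlinarith [sq_nonneg (x.num.eval u), sq_nonneg (x.denom.eval u)]
  have h2 : x.denom.eval u = 0 := by
    nlinarith [sq_nonneg (x.num.eval u), sq_nonneg (x.denom.eval u)]
  simp [h1, h2] at hab'

theorem RatFunc.one_add_sq_ne_zero (y : RatFunc ℝ) : 1 + y ^ 2 ≠ 0 := by
  have hd : algebraMap ℝ[X] (RatFunc ℝ) y.denom ≠ 0 := algebraMap_ne_zero y.denom_ne_zero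
  have hs : algebraMap ℝ[X] (RatFunc ℝ) (y.num ^ 2 + y.denom ^ 2) ≠ 0 :=
    algebraMap_ne_zero (ne_zero_of_forall_eval_ne_zero y.eval_num_sq_add_denom_sq_ne_zero)
  intro h
  apply hs
  rw [← y.num_div_denom] at h
  field_simp at h
  rw [map_add, map_pow, map_pow]
  linear_combination h

/-- Elements of the Dress ring have denominators without real roots and nonpositive degree. -/
theorem exists_eq_div_of_mem_dressD {z : RatFunc ℝ} (hz : z ∈ DressD) :
    ∃ f γ : ℝ[X], (∀ u, γ.eval u ≠ 0) ∧ f.natDegree ≤ γ.natDegree ∧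
      z = algebraMap ℝ[X] (RatFunc ℝ) f / algebraMap ℝ[X] (RatFunc ℝ) γ := by
  have hne {γ : ℝ[X]} (h : ∀ u, γ.eval u ≠ 0) : algebraMap ℝ[X] (RatFunc ℝ) γ ≠ 0 :=
    RatFunc.algebraMap_ne_zero (ne_zero_of_forall_eval_ne_zero h)
  induction hz using Subring.closure_induction with
  | mem z hz =>
    obtain ⟨x, rfl⟩ := hz
    have hroot := x.eval_num_sq_add_denom_sq_ne_zero
    refine ⟨x.denom ^ 2, x.num ^ 2 + x.denom ^ 2, hroot, natDegree_le_natDegree_sq_add_sq _ _, ?_⟩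
    have hd : algebraMap ℝ[X] (RatFunc ℝ) x.denom ≠ 0 := RatFunc.algebraMap_ne_zero x.denom_ne_zero
    have hs := hne hroot
    rw [map_add, map_pow, map_pow] at hs
    nth_rw 1 [← x.num_div_denom]
    rw [map_add, map_pow, map_pow, inv_eq_iff_eq_inv, inv_div, eq_div_iff (pow_ne_zero 2 hd)]
    field_simp
    ring
  | zero => exact ⟨0, 1, by simp, by simp, by simp⟩
  | one => exact ⟨1, 1, by simp, by simp, by simp⟩
  | add x y _ _ hx hy =>
    obtain ⟨f, γ, hγ, hd, rfl⟩ := hx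
    obtain ⟨g, δ, hδ, he, rfl⟩ := hy
    refine ⟨f * δ + γ * g, γ * δ, fun u => by simpa using ⟨hγ u, hδ u⟩, ?_, ?_⟩
    · rw [natDegree_mul (p := γ) (ne_zero_of_forall_eval_ne_zero hγ)
        (ne_zero_of_forall_eval_ne_zero hδ)]
      exact natDegree_add_le_of_degree_le (natDegree_mul_le.trans (by gcongr))
        (natDegree_mul_le.trans (by gcongr))
    · rw [div_add_div _ _ (hne hγ) (hne hδ)]; simp
  | neg x _ hx =>
    obtain ⟨f, γ, hγ, hd, rfl⟩ := hx
    exact ⟨-f, γ, hγ, by simpa using hd, by rw [map_neg, neg_div]⟩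
  | mul x y _ _ hx hy =>
    obtain ⟨f, γ, hγ, hd, rfl⟩ := hx
    obtain ⟨g, δ, hδ, he, rfl⟩ := hy
    refine ⟨f * g, γ * δ, fun u => by simpa using ⟨hγ u, hδ u⟩, ?_, ?_⟩
    · rw [natDegree_mul (p := γ) (ne_zero_of_forall_eval_ne_zero hγ)
        (ne_zero_of_forall_eval_ne_zero hδ)]
      exact natDegree_mul_le.trans (by gcongr)
    · rw [div_mul_div_comm, map_mul, map_mul]

theorem denom_eval_ne_zero_of_mem_dressD {z : RatFunc ℝ} (hz : z ∈ DressD) (u : ℝ) :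
    z.denom.eval u ≠ 0 := by
  obtain ⟨f, γ, hγ, -, rfl⟩ := exists_eq_div_of_mem_dressD hz
  exact fun h => hγ u (eval_eq_zero_of_dvd_of_eval_eq_zero (RatFunc.denom_div_dvd f γ) h)

theorem num_natDegree_le_of_mem_dressD {z : RatFunc ℝ} (hz : z ∈ DressD) :
    z.num.natDegree ≤ z.denom.natDegree := by
  obtain ⟨f, γ, hγ, hd, hfγ⟩ := exists_eq_div_of_mem_dressD hz
  have hγ0 : γ ≠ 0 := ne_zero_of_forall_eval_ne_zero hγ
  have hmul := (RatFunc.num_mul_eq_mul_denom_iff hγ0).2 hfγ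
  rcases eq_or_ne z.num 0 with h0 | h0
  · simp [h0]
  · have hdeg := congrArg natDegree hmul
    rw [natDegree_mul h0 hγ0] at hdeg
    have := natDegree_mul_le (p := f) (q := z.denom)
    lia

theorem algebraMap_C_mem_dressD (c : ℝ) : algebraMap ℝ[X] (RatFunc ℝ) (C c) ∈ DressD := by
  have key (r : ℝ) (h0 : 0 < r) (h1 : r ≤ 1) : algebraMap ℝ[X] (RatFunc ℝ) (C r) ∈ DressD := by
    refine Subring.subset_closure ⟨algebraMap ℝ[X] (RatFunc ℝ) (C √(r⁻¹ - 1)), ?_⟩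
    rw [← map_pow, ← map_one (algebraMap ℝ[X] (RatFunc ℝ)), ← map_add, ← C_pow, ← C_1, ← C_add,
      Real.sq_sqrt (sub_nonneg.2 ((one_le_inv₀ h0).2 h1)), add_sub_cancel, RatFunc.algebraMap_C,
      RatFunc.algebraMap_C, map_inv₀, inv_inv]
  have hfract : algebraMap ℝ[X] (RatFunc ℝ) (C (Int.fract c)) ∈ DressD := by
    rcases (Int.fract_nonneg c).eq_or_lt with h | h
    · simp [← h, DressD.zero_mem]
    · exact key _ h (Int.fract_lt_one c).le
  rw [← Int.floor_add_fract c, C_add, map_add]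
  refine DressD.add_mem ?_ hfract
  simp [intCast_mem DressD]

theorem inv_one_add_sq_mem_dressD (y : RatFunc ℝ) : (1 + y ^ 2)⁻¹ ∈ DressD :=
  Subring.subset_closure ⟨y, rfl⟩

theorem div_one_add_sq_mem_dressD (y : RatFunc ℝ) : y / (1 + y ^ 2) ∈ DressD := by
  have h2 : (1 + (1 : RatFunc ℝ) ^ 2)⁻¹ ∈ DressD := inv_one_add_sq_mem_dressD 1
  rcases eq_or_ne (1 + y) 0 with hy | hy
  · obtain rfl : y = -1 := by linear_combination hy
    simpa [neg_div] using h2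
  · have h := DressD.sub_mem (inv_one_add_sq_mem_dressD ((1 - y) / (1 + y))) h2
    have h0 := RatFunc.one_add_sq_ne_zero y
    have h1 := RatFunc.one_add_sq_ne_zero ((1 - y) / (1 + y))
    have h3 : (1 + y) ^ 2 + (1 - y) ^ 2 ≠ 0 := by
      intro h; apply h0; linear_combination h / 2
    convert h using 1
    have : (2 : RatFunc ℝ) ≠ 0 := two_ne_zero
    rw [show 1 + ((1 - y) / (1 + y)) ^ 2 = 2 * (1 + y ^ 2) / (1 + y) ^ 2 by field_simp; ring,
      show (1 : RatFunc ℝ) + 1 ^ 2 = 2 by norm_num]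
    field_simp
    ring

/-- Quotients with a positive definite quadratic denominator. -/
theorem div_quadratic_mem_dressD {f : ℝ[X]} (hf : f.natDegree ≤ 1) {a b : ℝ} (hb : b ≠ 0) :
    algebraMap ℝ[X] (RatFunc ℝ) f / algebraMap ℝ[X] (RatFunc ℝ) ((X - C a) ^ 2 + C (b ^ 2)) ∈
      DressD := by
  obtain ⟨s, t, rfl⟩ := exists_eq_X_add_C_of_natDegree_le_one hf
  set i := algebraMap ℝ[X] (RatFunc ℝ) with hi
  have hib : i (C b) ≠ 0 := RatFunc.algebraMap_ne_zero (C_ne_zero.2 hb)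
  have hib' : i (C b⁻¹) = (i (C b))⁻¹ := by
    refine eq_inv_of_mul_eq_one_left ?_
    rw [← map_mul, ← C_mul, inv_mul_cancel₀ hb, C_1, map_one]
  set y := (i X - i (C a)) / i (C b) with hy
  have h0 := RatFunc.one_add_sq_ne_zero y
  have hD : i ((X - C a) ^ 2 + C (b ^ 2)) = i (C b) ^ 2 * (1 + y ^ 2) := by
    simp only [map_add, map_pow, map_sub, hy]
    field_simp
    ring
  have hN : i (C s * X + C t) = i (C s) * i (C b) * y + i (C (s * a + t)) := by
    simp only [map_add, map_mul, hy]
    field_simp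
    ring
  have hmem : i (C b⁻¹) ^ 2 * (i (C s) * i (C b) * (y / (1 + y ^ 2)) +
      i (C (s * a + t)) * (1 + y ^ 2)⁻¹) ∈ DressD :=
    DressD.mul_mem (DressD.pow_mem (algebraMap_C_mem_dressD _) 2) (DressD.add_mem
      (DressD.mul_mem (DressD.mul_mem (algebraMap_C_mem_dressD _) (algebraMap_C_mem_dressD _))
        (div_one_add_sq_mem_dressD y))
      (DressD.mul_mem (algebraMap_C_mem_dressD _) (inv_one_add_sq_mem_dressD y)))
  convert hmem using 1
  rw [hD, hN, hib']
  field_simp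

theorem Polynomial.exists_quadratic_dvd_of_forall_eval_ne_zero {γ : ℝ[X]}
    (hγ : ∀ u, γ.eval u ≠ 0) (hdeg : γ.natDegree ≠ 0) :
    ∃ a b : ℝ, b ≠ 0 ∧ (X - C a) ^ 2 + C (b ^ 2) ∣ γ := by
  obtain ⟨z, hz⟩ := IsAlgClosed.exists_aeval_eq_zero ℂ γ
    fun h => hdeg (natDegree_eq_zero_iff_degree_le_zero.2 h.le)
  have him : z.im ≠ 0 := by
    intro h
    have hzre : z = (z.re : ℂ) := Complex.ext rfl (by simpa using h)
    rw [hzre] at hz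
    have : aeval (algebraMap ℝ ℂ z.re) γ = 0 := hz
    rw [aeval_algebraMap_apply, coe_aeval_eq_eval] at this
    exact hγ z.re (by simpa using this)
  refine ⟨z.re, z.im, him, ?_⟩
  convert quadratic_dvd_of_aeval_eq_zero_im_ne_zero γ hz him using 1
  rw [← Complex.normSq_eq_norm_sq, Complex.normSq_apply]
  simp only [C_add, C_mul, C_pow, C_ofNat]
  ring

theorem div_mem_dressD {f γ : ℝ[X]} (hγ : ∀ u, γ.eval u ≠ 0) (hdeg : f.natDegree ≤ γ.natDegree) :
    algebraMap ℝ[X] (RatFunc ℝ) f / algebraMap ℝ[X] (RatFunc ℝ) γ ∈ DressD := by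
  induction hn : γ.natDegree using Nat.strong_induction_on generalizing f γ with
  | _ n ih =>
  rcases eq_or_ne n 0 with rfl | hn0
  · obtain ⟨c, rfl⟩ := natDegree_eq_zero.1 hn
    obtain ⟨d, rfl⟩ := natDegree_eq_zero.1 (Nat.le_zero.1 (hdeg.trans_eq hn))
    rw [RatFunc.algebraMap_C, RatFunc.algebraMap_C, ← map_div₀, ← RatFunc.algebraMap_C]
    exact algebraMap_C_mem_dressD _
  obtain ⟨a, b, hb, δ, rfl⟩ := exists_quadratic_dvd_of_forall_eval_ne_zero hγ (hn ▸ hn0)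
  set Q : ℝ[X] := (X - C a) ^ 2 + C (b ^ 2) with hQ
  have hXa : ((X - C a) ^ 2 : ℝ[X]).Monic := (monic_X_sub_C a).pow 2
  have hXd : ((X - C a) ^ 2 : ℝ[X]).natDegree = 2 := by simp
  have hQd : Q.natDegree = 2 := by rw [hQ, natDegree_add_C, hXd]
  have hQm : Q.Monic := by
    refine hXa.add_of_left (degree_C_le.trans_lt ?_)
    rw [degree_eq_natDegree hXa.ne_zero, hXd]
    norm_num
  have hδ (u : ℝ) : δ.eval u ≠ 0 := fun h => hγ u (by simp [h])
  have hδ0 : δ ≠ 0 := ne_zero_of_forall_eval_ne_zero hδ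
  rw [natDegree_mul hQm.ne_zero hδ0, hQd] at hdeg hn
  have h1 := ih δ.natDegree (by lia) (f := f /ₘ Q) hδ
    (by rw [natDegree_divByMonic _ hQm]; lia) rfl
  have h2 := ih δ.natDegree (by lia) (f := 1) hδ (by simp) rfl
  have hr : (f %ₘ Q).natDegree ≤ 1 := by
    have := natDegree_modByMonic_lt f hQm (by intro h; simp [h] at hQd)
    lia
  have h3 := div_quadratic_mem_dressD hr (a := a) hb
  rw [← hQ] at h3
  convert DressD.add_mem h1 (DressD.mul_mem h3 h2) using 1
  have hQ0 := RatFunc.algebraMap_ne_zero hQm.ne_zero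
  have hδ0' := RatFunc.algebraMap_ne_zero hδ0
  nth_rw 1 [← modByMonic_add_div f Q]
  simp only [map_add, map_mul, map_one]
  field_simp
  ring

/-- A polynomial of degree at most `2 deg f`, positive at the real roots of `f`, becomes positive
everywhere, with degree exactly `2 deg f`, after adding a large multiple of `f²`. -/
theorem Polynomial.exists_pos_add_mul_sq {f g : ℝ[X]} (hf : f ≠ 0)
    (hdeg : g.natDegree ≤ 2 * f.natDegree) (hpos : ∀ u, f.eval u = 0 → 0 < g.eval u) :
    ∃ M : ℝ, (∀ u, 0 < (g + C M * f ^ 2).eval u) ∧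
      (g + C M * f ^ 2).natDegree = 2 * f.natDegree := by
  have hO : g.eval =O[Bornology.cobounded ℝ] (f ^ 2).eval := by
    refine isBigO_cobounded_of_degree_le ?_
    rw [degree_eq_natDegree (pow_ne_zero 2 hf), natDegree_pow]
    exact natDegree_le_iff_degree_le.1 hdeg
  obtain ⟨c, hc⟩ := hO.bound
  rw [Metric.cobounded_eq_cocompact, Filter.eventually_iff,
    Filter.mem_cocompact] at hc
  obtain ⟨K, hK, hKc⟩ := hc
  have hcl : IsClosed {u : ℝ | g.eval u ≤ 0} := isClosed_le g.continuous continuous_const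
  obtain ⟨B, hB⟩ := (hK.inter_right hcl).exists_bound_of_continuousOn
    (f := fun u => g.eval u / f.eval u ^ 2)
    (g.continuous.continuousOn.div (f.continuous.pow 2).continuousOn fun u hu =>
      pow_ne_zero 2 fun h => (hpos u h).not_ge hu.2)
  set l := f.leadingCoeff
  have hl : 0 < l ^ 2 := by
    have : l ≠ 0 := leadingCoeff_ne_zero.2 hf
    positivity
  set e := g.coeff (2 * f.natDegree)
  set M := max (max B c) (max 0 (|e| / l ^ 2)) + 1 with hM
  have hMB : B < M := by
    rw [hM]; exact lt_add_of_le_of_pos ((le_max_left _ _).trans (le_max_left _ _)) one_pos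
  have hMc : c < M := by
    rw [hM]; exact lt_add_of_le_of_pos ((le_max_right _ _).trans (le_max_left _ _)) one_pos
  have hM0 : 0 < M := by
    rw [hM]; exact lt_add_of_le_of_pos ((le_max_left _ _).trans (le_max_right _ _)) one_pos
  have hMe : |e| / l ^ 2 < M := by
    rw [hM]; exact lt_add_of_le_of_pos ((le_max_right _ _).trans (le_max_right _ _)) one_pos
  refine ⟨M, fun u => ?_, ?_⟩
  · simp only [eval_add, eval_mul, eval_C, eval_pow]
    rcases lt_or_ge 0 (g.eval u) with hg | hg
    · positivity
    have hfu : f.eval u ≠ 0 := fun h => (hpos u h).not_ge hg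
    have hfu2 : 0 < f.eval u ^ 2 := by positivity
    by_cases hu : u ∈ K
    · have h := hB u ⟨hu, hg⟩
      rw [Real.norm_eq_abs, abs_div, abs_of_pos hfu2, div_le_iff₀ hfu2] at h
      nlinarith [neg_abs_le (g.eval u)]
    · have h : ‖g.eval u‖ ≤ c * ‖(f ^ 2).eval u‖ := hKc hu
      rw [Real.norm_eq_abs, Real.norm_eq_abs, eval_pow, abs_of_pos hfu2] at h
      nlinarith [neg_abs_le (g.eval u)]
  · refine natDegree_eq_of_le_of_coeff_ne_zero ?_ ?_
    · refine natDegree_add_le_of_degree_le hdeg ((natDegree_C_mul_le _ _).trans ?_)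
      rw [natDegree_pow]
    · rw [coeff_add, coeff_C_mul, coeff_pow_of_natDegree_le le_rfl, coeff_natDegree]
      rw [div_lt_iff₀ hl] at hMe
      have := neg_abs_le e
      exact (by linarith : 0 < e + M * l ^ 2).ne'

theorem exists_dressD_eq_div {f γ : ℝ[X]} (hγ : ∀ u, γ.eval u ≠ 0)
    (hdeg : f.natDegree ≤ γ.natDegree) :
    ∃ d : DressD, (d : RatFunc ℝ) =
      algebraMap ℝ[X] (RatFunc ℝ) f / algebraMap ℝ[X] (RatFunc ℝ) γ :=
  ⟨⟨_, div_mem_dressD hγ hdeg⟩, rfl⟩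

theorem Polynomial.eval_X_sq_add_one_pow_pos (k : ℕ) (u : ℝ) :
    0 < ((X ^ 2 + 1 : ℝ[X]) ^ k).eval u := by
  simp only [eval_pow, eval_add, eval_X, eval_one]
  positivity

theorem Polynomial.natDegree_X_sq_add_one_pow (k : ℕ) :
    ((X ^ 2 + 1 : ℝ[X]) ^ k).natDegree = 2 * k := by
  rw [natDegree_pow, ← C_1, natDegree_X_pow_add_C, mul_comm]

theorem Polynomial.monic_X_sq_add_one_pow (k : ℕ) : ((X ^ 2 + 1 : ℝ[X]) ^ k).Monic := by
  rw [← C_1]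
  exact (monic_X_pow_add_C 1 two_ne_zero).pow k

/-- If `f` does not vanish at infinity, then `g / (1 + X²)ᵏ` can be made a unit. -/
theorem isIdempotentRow_of_natDegree_eq_two_mul {f g : ℝ[X]} {k : ℕ} (hf : f ≠ 0)
    (hdf : f.natDegree = 2 * k) (hdg : g.natDegree ≤ 2 * k)
    (hpos : ∀ u, f.eval u = 0 → 0 < g.eval u) {P Q : DressD}
    (hP : (P : RatFunc ℝ) =
      algebraMap ℝ[X] (RatFunc ℝ) f / algebraMap ℝ[X] (RatFunc ℝ) ((X ^ 2 + 1) ^ k))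
    (hQ : (Q : RatFunc ℝ) =
      algebraMap ℝ[X] (RatFunc ℝ) g / algebraMap ℝ[X] (RatFunc ℝ) ((X ^ 2 + 1) ^ k)) :
    IsIdempotentRow P Q := by
  obtain ⟨M, hM, hMd⟩ := exists_pos_add_mul_sq (g := g * (X ^ 2 + 1) ^ k) hf
    (natDegree_mul_le.trans (by rw [natDegree_X_sq_add_one_pow]; lia)) fun u hu => by
      rw [eval_mul]; exact mul_pos (hpos u hu) (eval_X_sq_add_one_pow_pos k u)
  set w : ℝ[X] := (X ^ 2 + 1) ^ k with hw
  set h := g * w + C M * f ^ 2 with hh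
  have hh0 : h ≠ 0 := ne_zero_of_forall_eval_ne_zero fun u => (hM u).ne'
  obtain ⟨a, ha⟩ := exists_dressD_eq_div (f := f * w) (fun u => (hM u).ne') (by
    refine natDegree_mul_le.trans ?_
    rw [hw, natDegree_X_sq_add_one_pow, hMd]; lia)
  obtain ⟨m, hm⟩ : ∃ m : DressD, (m : RatFunc ℝ) = algebraMap ℝ[X] (RatFunc ℝ) (C M) :=
    ⟨⟨_, algebraMap_C_mem_dressD M⟩, rfl⟩
  have hw0 := RatFunc.algebraMap_ne_zero (monic_X_sq_add_one_pow k).ne_zero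
  rw [← hw] at hw0
  have hh0' := RatFunc.algebraMap_ne_zero hh0
  have hrow := (isIdempotentRow_mul_left a (Q + m * P * P)).add_mul_right (-(m * P))
  have hPa : P = a * (Q + m * P * P) := by
    apply Subtype.ext
    push_cast
    rw [hP, hQ, ha, hm]
    field_simp
    simp only [hh, map_add, map_mul, map_pow]
    ring
  rw [← hPa] at hrow
  convert hrow using 1
  ring

theorem isIdempotentRow_linear_div (c : ℝ) {P Q : DressD}
    (hP : (P : RatFunc ℝ) = algebraMap ℝ[X] (RatFunc ℝ) (C c * X) /
      algebraMap ℝ[X] (RatFunc ℝ) (X ^ 2 + 1))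
    (hQ : (Q : RatFunc ℝ) = 1 / algebraMap ℝ[X] (RatFunc ℝ) (X ^ 2 + 1)) (hc : c ≠ 0) :
    IsIdempotentRow P Q := by
  have hw (u : ℝ) : (X ^ 2 + 1 : ℝ[X]).eval u ≠ 0 := by
    simpa using (eval_X_sq_add_one_pow_pos 1 u).ne'
  have hwd : (X ^ 2 + 1 : ℝ[X]).natDegree = 2 := by simpa using natDegree_X_sq_add_one_pow 1
  obtain ⟨a, ha⟩ := exists_dressD_eq_div (f := X ^ 2) hw (by simp [hwd])
  obtain ⟨b, hb⟩ := exists_dressD_eq_div (f := C c⁻¹ * X) hw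
    ((natDegree_C_mul_le _ _).trans (by simp [hwd]))
  have hw0 := RatFunc.algebraMap_ne_zero (ne_zero_of_forall_eval_ne_zero hw)
  have hcc : algebraMap ℝ[X] (RatFunc ℝ) (C c⁻¹) * algebraMap ℝ[X] (RatFunc ℝ) (C c) = 1 := by
    rw [← map_mul, ← C_mul, inv_mul_cancel₀ hc, C_1, map_one]
  have hsum : a + Q = 1 := by
    apply Subtype.ext
    push_cast
    rw [ha, hQ, ← add_div, ← map_one (algebraMap ℝ[X] (RatFunc ℝ)), ← map_add, div_self hw0,
      map_one]
  have hdet : b * P = a * Q := by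
    apply Subtype.ext
    push_cast
    rw [ha, hQ, hb, hP]
    rw [map_mul, map_mul, map_pow, div_mul_div_comm, div_mul_div_comm]
    congr 1
    linear_combination (algebraMap ℝ[X] (RatFunc ℝ) X) ^ 2 * hcc
  refine isIdempotentRow_of_isIdempotentElem (a := a) (b := b) ?_
  obtain rfl : Q = 1 - a := by linear_combination hsum
  rw [IsIdempotentElem, Matrix.mul_fin_two]
  congrm !![?_, ?_; ?_, ?_]
  · linear_combination hdet
  · ring
  · ring
  · linear_combination hdet

/-- If `f` has a simple zero at infinity, then the row can be reduced to
`(c X / (1 + X²), 1 / (1 + X²))`. -/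
theorem isIdempotentRow_of_natDegree_eq_two_mul_add_one {f g : ℝ[X]} {k : ℕ}
    (hdf : f.natDegree = 2 * k + 1) (hdg : g.natDegree ≤ 2 * k)
    (hpos : ∀ u, f.eval u = 0 → 0 < g.eval u) {P Q : DressD}
    (hP : (P : RatFunc ℝ) =
      algebraMap ℝ[X] (RatFunc ℝ) f / algebraMap ℝ[X] (RatFunc ℝ) ((X ^ 2 + 1) ^ (k + 1)))
    (hQ : (Q : RatFunc ℝ) =
      algebraMap ℝ[X] (RatFunc ℝ) g / algebraMap ℝ[X] (RatFunc ℝ) ((X ^ 2 + 1) ^ (k + 1))) :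
    IsIdempotentRow P Q := by
  have hf : f ≠ 0 := by rintro rfl; simp at hdf
  obtain ⟨M, hM, hMd⟩ := exists_pos_add_mul_sq (g := g * (X ^ 2 + 1) ^ (k + 1)) hf
    (natDegree_mul_le.trans (by rw [natDegree_X_sq_add_one_pow]; lia)) fun u hu => by
      rw [eval_mul]; exact mul_pos (hpos u hu) (eval_X_sq_add_one_pow_pos (k + 1) u)
  set h := g * (X ^ 2 + 1) ^ (k + 1) + C M * f ^ 2 with hh
  have hroot (u : ℝ) : h.eval u ≠ 0 := (hM u).ne'
  have hh0 : h ≠ 0 := ne_zero_of_forall_eval_ne_zero hroot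
  set c := f.leadingCoeff / h.leadingCoeff with hc
  have hlf := leadingCoeff_ne_zero.2 hf
  have hlh := leadingCoeff_ne_zero.2 hh0
  have hc0 : c ≠ 0 := div_ne_zero hlf hlh
  have hwd (u : ℝ) : (X ^ 2 + 1 : ℝ[X]).eval u ≠ 0 := by
    simpa using (eval_X_sq_add_one_pow_pos 1 u).ne'
  have hwdeg : (X ^ 2 + 1 : ℝ[X]).natDegree = 2 := by simpa using natDegree_X_sq_add_one_pow 1
  obtain ⟨d, hd⟩ := exists_dressD_eq_div (f := h) (γ := (X ^ 2 + 1) ^ (2 * k + 1))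
    (fun u => (eval_X_sq_add_one_pow_pos _ u).ne')
    (by rw [natDegree_X_sq_add_one_pow, hMd, hdf])
  obtain ⟨y, hy⟩ := exists_dressD_eq_div (f := C c * X) hwd
    ((natDegree_C_mul_le _ _).trans (by simp [hwdeg]))
  obtain ⟨z, hz⟩ := exists_dressD_eq_div (f := 1) hwd (by simp)
  rw [map_one] at hz
  obtain ⟨m, hm⟩ : ∃ m : DressD, (m : RatFunc ℝ) = algebraMap ℝ[X] (RatFunc ℝ) (C M) :=
    ⟨⟨_, algebraMap_C_mem_dressD M⟩, rfl⟩
  obtain ⟨e, he⟩ := exists_dressD_eq_div (f := f * (X ^ 2 + 1) ^ (k + 1) - C c * X * h) hroot (by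
    have hdeg₁ : (f * (X ^ 2 + 1) ^ (k + 1)).natDegree = 4 * k + 3 := by
      rw [natDegree_mul hf (monic_X_sq_add_one_pow _).ne_zero, natDegree_X_sq_add_one_pow, hdf]
      ring
    have hdeg₂ : (C c * X * h).natDegree = 4 * k + 3 := by
      rw [natDegree_mul (by simpa using hc0) hh0, natDegree_C_mul_X _ hc0, hMd, hdf]
      ring
    have hlt := degree_sub_lt_left (p := f * (X ^ 2 + 1) ^ (k + 1)) (q := C c * X * h)
      (by rw [degree_eq_natDegree, degree_eq_natDegree, hdeg₁, hdeg₂] <;>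
        (rintro h0; simp [h0] at hdeg₁ hdeg₂))
      (by rintro h0; simp [h0] at hdeg₁)
      (by
        rw [leadingCoeff_mul, (monic_X_sq_add_one_pow _).leadingCoeff, leadingCoeff_mul,
          leadingCoeff_mul, leadingCoeff_C, leadingCoeff_X, hc]
        field_simp)
    have hlt' : (f * (X ^ 2 + 1) ^ (k + 1) - C c * X * h).natDegree < 4 * k + 3 := by
      rcases eq_or_ne (f * (X ^ 2 + 1) ^ (k + 1) - C c * X * h) 0 with h0 | h0
      · simp [h0]
      · exact hdeg₁ ▸ natDegree_lt_natDegree h0 hlt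
    rw [hMd, hdf]; lia)
  have hw0 := RatFunc.algebraMap_ne_zero (ne_zero_of_forall_eval_ne_zero hwd)
  have hh0' := RatFunc.algebraMap_ne_zero hh0
  have hrow := ((isIdempotentRow_linear_div c hy hz hc0).add_mul_left e).smul d
  have hPd : P = d * (y + e * z) := by
    apply Subtype.ext
    push_cast
    rw [hP, hd, hy, he, hz]
    simp only [map_sub, map_mul _ f, map_mul _ _ h, map_pow]
    field_simp
    ring
  have hQd : Q + m * P * P = d * z := by
    apply Subtype.ext
    push_cast
    rw [hP, hQ, hd, hm, hz, hh]
    simp only [map_add _ (g * _), map_mul _ g, map_mul _ (C M), map_pow]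
    field_simp
    ring
  rw [← hPd, ← hQd] at hrow
  convert hrow.add_mul_right (-(m * P)) using 1
  ring

theorem isIdempotentRow_of_forall_pos {f g γ : ℝ[X]} {P Q : DressD} (hf : f ≠ 0)
    (hγ : ∀ u, γ.eval u ≠ 0) (hdf : f.natDegree ≤ 2 * (γ.natDegree / 2))
    (hdg : g.natDegree ≤ f.natDegree) (hpos : ∀ u, f.eval u = 0 → 0 < g.eval u)
    (hP : (P : RatFunc ℝ) = algebraMap ℝ[X] (RatFunc ℝ) f / algebraMap ℝ[X] (RatFunc ℝ) γ)
    (hQ : (Q : RatFunc ℝ) = algebraMap ℝ[X] (RatFunc ℝ) g / algebraMap ℝ[X] (RatFunc ℝ) γ) :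
    IsIdempotentRow P Q := by
  have hγ0 := RatFunc.algebraMap_ne_zero (ne_zero_of_forall_eval_ne_zero hγ)
  have reduce (k : ℕ) (hfk : f.natDegree ≤ 2 * k) (hkγ : 2 * k ≤ γ.natDegree)
      (hrow : ∀ A B : DressD,
        (A : RatFunc ℝ) =
          algebraMap ℝ[X] (RatFunc ℝ) f / algebraMap ℝ[X] (RatFunc ℝ) ((X ^ 2 + 1) ^ k) →
        (B : RatFunc ℝ) =
          algebraMap ℝ[X] (RatFunc ℝ) g / algebraMap ℝ[X] (RatFunc ℝ) ((X ^ 2 + 1) ^ k) →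
        IsIdempotentRow A B) : IsIdempotentRow P Q := by
    have hw0 := RatFunc.algebraMap_ne_zero (monic_X_sq_add_one_pow k).ne_zero
    have hwr (u : ℝ) := (eval_X_sq_add_one_pow_pos k u).ne'
    obtain ⟨d, hd⟩ := exists_dressD_eq_div (f := (X ^ 2 + 1) ^ k) hγ
      (by rwa [natDegree_X_sq_add_one_pow])
    obtain ⟨A, hA⟩ := exists_dressD_eq_div (f := f) hwr (by rwa [natDegree_X_sq_add_one_pow])
    obtain ⟨B, hB⟩ := exists_dressD_eq_div (f := g) hwr
      (by rw [natDegree_X_sq_add_one_pow]; exact hdg.trans hfk)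
    convert (hrow A B hA hB).smul d using 1
    · apply Subtype.ext
      push_cast
      rw [hP, hd, hA]
      field_simp
    · apply Subtype.ext
      push_cast
      rw [hQ, hd, hB]
      field_simp
  rcases Nat.even_or_odd' f.natDegree with ⟨k, hk | hk⟩
  · exact reduce k hk.le (by lia) fun A B hA hB =>
      isIdempotentRow_of_natDegree_eq_two_mul hf hk (hdg.trans_eq hk) hpos hA hB
  · refine reduce (k + 1) (by lia) (by lia) fun A B hA hB => ?_
    set c := g.coeff (2 * k + 1) / f.leadingCoeff with hc
    obtain ⟨m, hm⟩ : ∃ m : DressD, (m : RatFunc ℝ) = algebraMap ℝ[X] (RatFunc ℝ) (C c) :=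
      ⟨⟨_, algebraMap_C_mem_dressD c⟩, rfl⟩
    have hdeg : (g - C c * f).natDegree ≤ 2 * k := by
      rw [natDegree_le_iff_coeff_eq_zero]
      intro N hN
      rw [coeff_sub, coeff_C_mul]
      rcases (Nat.succ_le_of_lt hN).eq_or_lt with rfl | hN'
      · have hl : f.coeff (2 * k + 1) = f.leadingCoeff := by rw [← hk, coeff_natDegree]
        rw [Nat.succ_eq_add_one, hl, hc, div_mul_cancel₀ _ (leadingCoeff_ne_zero.2 hf), sub_self]
      · rw [coeff_eq_zero_of_natDegree_lt (by lia), coeff_eq_zero_of_natDegree_lt (by lia)]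
        simp
    have hrow := isIdempotentRow_of_natDegree_eq_two_mul_add_one (g := g - C c * f)
      (P := A) (Q := B - m * A) hk hdeg (fun u hu => by simpa [hu] using hpos u hu) hA (by
        rw [AddSubgroupClass.coe_sub, Subring.coe_mul, hA, hB, hm,
          map_sub (algebraMap ℝ[X] (RatFunc ℝ)), map_mul (algebraMap ℝ[X] (RatFunc ℝ))]
        ring)
    convert hrow.add_mul_right m using 1
    ring

theorem isIdempotentRow_of_evalD_pos {p q : DressD}
    (hdeg : RatFunc.intDegree (q : RatFunc ℝ) ≤ RatFunc.intDegree (p : RatFunc ℝ))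
    (hpos : ∀ u : ℝ, evalD p u = 0 → 0 < evalD q u) : IsIdempotentRow p q := by
  rcases eq_or_ne p 0 with rfl | hp
  · exact isIdempotentRow_zero_left q
  rcases eq_or_ne q 0 with rfl | hq
  · exact (isIdempotentRow_zero_left p).swap
  have hγ := denom_eval_ne_zero_of_mem_dressD p.2
  have hδ := denom_eval_ne_zero_of_mem_dressD q.2
  have hdp := num_natDegree_le_of_mem_dressD p.2
  set f := (p : RatFunc ℝ).num
  set γ := (p : RatFunc ℝ).denom
  set g := (q : RatFunc ℝ).num
  set δ := (q : RatFunc ℝ).denom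
  have hf0 : f ≠ 0 := RatFunc.num_ne_zero (by simpa using hp)
  have hg0 : g ≠ 0 := RatFunc.num_ne_zero (by simpa using hq)
  have hγ0 : γ ≠ 0 := RatFunc.denom_ne_zero _
  have hδ0 : δ ≠ 0 := RatFunc.denom_ne_zero _
  have hγ0' := RatFunc.algebraMap_ne_zero hγ0
  have hδ0' := RatFunc.algebraMap_ne_zero hδ0
  have hdeg' : (g.natDegree : ℤ) - δ.natDegree ≤ f.natDegree - γ.natDegree := hdeg
  have hep (u : ℝ) : evalD p u = f.eval u / γ.eval u := rfl
  have heq (u : ℝ) : evalD q u = g.eval u / δ.eval u := rfl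
  refine isIdempotentRow_of_forall_pos (f := f * δ * (γ * δ)) (g := g * γ * (γ * δ))
    (γ := (γ * δ) ^ 2) (mul_ne_zero (mul_ne_zero hf0 hδ0) (mul_ne_zero hγ0 hδ0))
    (fun u => by simp [hγ u, hδ u]) ?_ ?_ (fun u hu => ?_) ?_ ?_
  · simp only [natDegree_pow, natDegree_mul, hf0, hγ0, hδ0, ne_eq, mul_eq_zero, or_self,
      not_false_eq_true]
    lia
  · simp only [natDegree_mul, hf0, hg0, hγ0, hδ0, ne_eq, mul_eq_zero, or_self,
      not_false_eq_true]
    lia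
  · have hfu : f.eval u = 0 := by simpa [hγ u, hδ u] using hu
    have hgu := hpos u (by rw [hep, hfu, zero_div])
    rw [heq] at hgu
    have h1 := hγ u
    have h2 := hδ u
    have : (g * γ * (γ * δ)).eval u = g.eval u / δ.eval u * (γ.eval u * δ.eval u) ^ 2 := by
      simp only [eval_mul]
      field_simp
    rw [this]
    positivity
  · rw [← RatFunc.num_div_denom (p : RatFunc ℝ)]
    simp only [map_mul, map_pow]
    change algebraMap _ _ f / algebraMap _ _ γ = _
    field_simp
  · rw [← RatFunc.num_div_denom (q : RatFunc ℝ)]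
    simp only [map_mul, map_pow]
    change algebraMap _ _ g / algebraMap _ _ δ = _
    field_simp

theorem evalD_neg (q : DressD) (u : ℝ) : evalD (-q) u = -evalD q u := by
  have hd : (q : RatFunc ℝ).denom.eval u ≠ 0 := denom_eval_ne_zero_of_mem_dressD q.2 u
  have hd' : (-q : RatFunc ℝ).denom.eval u ≠ 0 := denom_eval_ne_zero_of_mem_dressD (-q).2 u
  have h := congrArg (eval u) (RatFunc.num_denom_neg (q : RatFunc ℝ))
  simp only [eval_mul, eval_neg] at h
  change eval u (-q : RatFunc ℝ).num / eval u (-q : RatFunc ℝ).denom =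
    -(eval u (q : RatFunc ℝ).num / eval u (q : RatFunc ℝ).denom)
  rw [← neg_div, div_eq_div_iff hd' hd, h]

theorem stmt_4 (p q : DressD)
    (hdeg : RatFunc.intDegree (q : RatFunc ℝ) ≤ RatFunc.intDegree (p : RatFunc ℝ))
    (hsign : (∀ u : ℝ, evalD p u = 0 → 0 < evalD q u) ∨
             (∀ u : ℝ, evalD p u = 0 → evalD q u < 0)) :
    IsProductOfIdempotents (!![p, q; 0, 0] : Matrix (Fin 2) (Fin 2) DressD) := by
  rcases hsign with hpos | hneg
  · exact isIdempotentRow_of_evalD_pos hdeg hpos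
  · have hrow : IsIdempotentRow p (-q) := by
      refine isIdempotentRow_of_evalD_pos (by simpa using hdeg) fun u hu => ?_
      rw [evalD_neg]
      exact neg_pos.2 (hneg u hu)
    have hrow' := hrow.neg_right
    rwa [neg_neg] at hrow'
end

section
/- Let p, q ∈ D be weakly comaximal. If p(u) ≤ 0 for every u ∈ ℝ, or q(u) ≤ 0 for every u ∈ ℝ, then the matrix [[p, q], [0, 0]] ∈ M₂(D) is a product of idempotent matrices over D. -/
open Polynomial

namespace DressRing

section Rows

variable {R : Type*} [CommRing R]

theorem isProductOfIdempotents_of_isIdempotentElem {A : Matrix (Fin 2) (Fin 2) R}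
    (hA : IsIdempotentElem A) : IsProductOfIdempotents A :=
  ⟨[A], by simpa using hA, by simp⟩

theorem isProductOfIdempotents_mul {A B : Matrix (Fin 2) (Fin 2) R}
    (hA : IsProductOfIdempotents A) (hB : IsProductOfIdempotents B) :
    IsProductOfIdempotents (A * B) := by
  obtain ⟨L, hL, rfl⟩ := hA
  obtain ⟨L', hL', rfl⟩ := hB
  refine ⟨L ++ L', fun T hT => ?_, by simp⟩
  rcases List.mem_append.1 hT with h | h
  exacts [hL T h, hL' T h]

theorem isProductOfIdempotents_conj {A G H : Matrix (Fin 2) (Fin 2) R} (hGH : G * H = 1)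
    (hA : IsProductOfIdempotents A) : IsProductOfIdempotents (H * A * G) := by
  have hHG : H * G = 1 := mul_eq_one_comm.1 hGH
  obtain ⟨L, hL, rfl⟩ := hA
  refine ⟨L.map fun T => H * T * G, ?_, ?_⟩
  · simp only [List.mem_map]
    rintro _ ⟨T, hT, rfl⟩
    have := hL T hT
    unfold IsIdempotentElem at this ⊢
    calc H * T * G * (H * T * G) = H * T * (G * H) * T * G := by simp only [mul_assoc]
      _ = H * (T * T) * G := by rw [hGH]; simp only [mul_assoc, mul_one]
      _ = _ := by rw [this]
  · clear hL
    induction L with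
    | nil => simp [hHG]
    | cons T L ih =>
      rw [List.map_cons, List.prod_cons, ih, List.prod_cons]
      calc H * T * G * (H * L.prod * G) = H * T * (G * H) * L.prod * G := by
            simp only [mul_assoc]
        _ = _ := by rw [hGH]; simp only [mul_assoc, mul_one]

theorem row_isProductOfIdempotents_of_fst_eq_one (x : R) :
    IsProductOfIdempotents (!![1, x; 0, 0] : Matrix (Fin 2) (Fin 2) R) := by
  apply isProductOfIdempotents_of_isIdempotentElem
  unfold IsIdempotentElem
  ext i j
  fin_cases i <;> fin_cases j <;> simp

theorem row_isProductOfIdempotents_of_idempotent {a b c d : R}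
    (h : IsIdempotentElem (!![a, b; c, d] : Matrix (Fin 2) (Fin 2) R)) :
    IsProductOfIdempotents (!![a, b; 0, 0] : Matrix (Fin 2) (Fin 2) R) := by
  convert isProductOfIdempotents_mul (row_isProductOfIdempotents_of_fst_eq_one (0 : R))
    (isProductOfIdempotents_of_isIdempotentElem h) using 1
  simp

theorem row_isProductOfIdempotents_of_snd_eq_zero (x : R) :
    IsProductOfIdempotents (!![x, 0; 0, 0] : Matrix (Fin 2) (Fin 2) R) := by
  have h : IsIdempotentElem (!![x, x; 1 - x, 1 - x] : Matrix (Fin 2) (Fin 2) R) := by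
    unfold IsIdempotentElem
    ext i j
    fin_cases i <;> fin_cases j <;> simp <;> ring
  convert isProductOfIdempotents_mul (row_isProductOfIdempotents_of_idempotent h)
    (row_isProductOfIdempotents_of_fst_eq_one (0 : R)) using 1
  simp

theorem row_smul_isProductOfIdempotents (x : R) {a b : R}
    (h : IsProductOfIdempotents (!![a, b; 0, 0] : Matrix (Fin 2) (Fin 2) R)) :
    IsProductOfIdempotents (!![x * a, x * b; 0, 0] : Matrix (Fin 2) (Fin 2) R) := by
  convert isProductOfIdempotents_mul (row_isProductOfIdempotents_of_snd_eq_zero x) h using 1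
  simp

/-- Right multiplication of a row by an invertible matrix `G` preserves being a product of
idempotents as soon as the first row of `G` has this property. -/
theorem row_mul_isProductOfIdempotents {a b : R} {G H : Matrix (Fin 2) (Fin 2) R}
    (hGH : G * H = 1)
    (hG : IsProductOfIdempotents (!![G 0 0, G 0 1; 0, 0] : Matrix (Fin 2) (Fin 2) R))
    (h : IsProductOfIdempotents (!![a, b; 0, 0] : Matrix (Fin 2) (Fin 2) R)) :
    IsProductOfIdempotents (!![a, b; 0, 0] * G) := by
  have h1 : (!![G 0 0, G 0 1; 0, 0] : Matrix (Fin 2) (Fin 2) R) = !![1, 0; 0, 0] * G := by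
    ext i j
    fin_cases i <;> fin_cases j <;> simp [Matrix.mul_apply]
  have h2 : (!![1, 0; 0, 0] : Matrix (Fin 2) (Fin 2) R) * !![a, b; 0, 0] = !![a, b; 0, 0] := by
    ext i j
    fin_cases i <;> fin_cases j <;> simp
  convert isProductOfIdempotents_mul hG (isProductOfIdempotents_conj hGH h) using 1
  rw [h1]
  calc !![a, b; 0, 0] * G = !![1, 0; 0, 0] * !![a, b; 0, 0] * G := by rw [h2]
    _ = !![1, 0; 0, 0] * (G * H) * !![a, b; 0, 0] * G := by rw [hGH, mul_one]
    _ = _ := by simp only [mul_assoc]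

theorem row_add_mul_snd_isProductOfIdempotents (x : R) {a b : R}
    (h : IsProductOfIdempotents (!![a, b + x * a; 0, 0] : Matrix (Fin 2) (Fin 2) R)) :
    IsProductOfIdempotents (!![a, b; 0, 0] : Matrix (Fin 2) (Fin 2) R) := by
  convert row_mul_isProductOfIdempotents (G := !![1, -x; 0, 1]) (H := !![1, x; 0, 1])
    (by simp [Matrix.one_fin_two]) (row_isProductOfIdempotents_of_fst_eq_one _) h using 1
  simp; ring

theorem row_add_mul_fst_isProductOfIdempotents (x : R) {a b : R}
    (h : IsProductOfIdempotents (!![a + x * b, b; 0, 0] : Matrix (Fin 2) (Fin 2) R)) :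
    IsProductOfIdempotents (!![a, b; 0, 0] : Matrix (Fin 2) (Fin 2) R) := by
  convert row_mul_isProductOfIdempotents (G := !![1, 0; -x, 1]) (H := !![1, 0; x, 1])
    (by simp [Matrix.one_fin_two]) (row_isProductOfIdempotents_of_fst_eq_one _) h using 1
  simp; ring

theorem row_units_mul_isProductOfIdempotents (u v : Rˣ) {a b : R}
    (h : IsProductOfIdempotents (!![a, b; 0, 0] : Matrix (Fin 2) (Fin 2) R)) :
    IsProductOfIdempotents (!![u * a, v * b; 0, 0] : Matrix (Fin 2) (Fin 2) R) := by
  convert row_mul_isProductOfIdempotents (G := !![(u : R), 0; 0, v])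
    (H := !![((u⁻¹ : Rˣ) : R), 0; 0, ((v⁻¹ : Rˣ) : R)])
    (by simp [Matrix.one_fin_two]) (row_isProductOfIdempotents_of_snd_eq_zero _) h using 1
  simp [mul_comm]

theorem row_swap_isProductOfIdempotents {a b : R}
    (h : IsProductOfIdempotents (!![a, b; 0, 0] : Matrix (Fin 2) (Fin 2) R)) :
    IsProductOfIdempotents (!![b, a; 0, 0] : Matrix (Fin 2) (Fin 2) R) := by
  have h01 : IsProductOfIdempotents (!![0, 1; 0, 0] : Matrix (Fin 2) (Fin 2) R) := by
    convert isProductOfIdempotents_mul (row_isProductOfIdempotents_of_fst_eq_one (1 : R))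
      (isProductOfIdempotents_of_isIdempotentElem (A := !![0, 0; 0, 1])
        (by
          unfold IsIdempotentElem
          ext i j
          fin_cases i <;> fin_cases j <;> simp)) using 1
    ext i j
    fin_cases i <;> fin_cases j <;> simp
  convert row_mul_isProductOfIdempotents (G := !![0, 1; 1, 0]) (H := !![0, 1; 1, 0])
    (by simp [Matrix.one_fin_two]) h01 h using 1
  ext i j
  fin_cases i <;> fin_cases j <;> simp

end Rows

section Membership

local notation "ι" => algebraMap ℝ[X] (RatFunc ℝ)

theorem inv_one_add_sq_mem (x : RatFunc ℝ) : (1 + x ^ 2)⁻¹ ∈ DressD :=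
  Subring.subset_closure ⟨x, rfl⟩

theorem algebraMap_C_mem (c : ℝ) : ι (C c) ∈ DressD := by
  have key : ∀ c : ℝ, 0 < c → c ≤ 1 → ι (C c) ∈ DressD := by
    intro c h0 h1
    have h2 : 0 ≤ c⁻¹ - 1 := sub_nonneg.2 ((one_le_inv₀ h0).2 h1)
    have h3 : (1 + ι (C √(c⁻¹ - 1)) ^ 2)⁻¹ = ι (C c) := by
      rw [← map_pow, ← map_pow, Real.sq_sqrt h2, ← map_one ι, ← C_1, ← map_add, ← map_add,
        add_sub_cancel]
      apply inv_eq_of_mul_eq_one_right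
      rw [← map_mul, ← map_mul, inv_mul_cancel₀ h0.ne', C_1, map_one]
    exact h3 ▸ inv_one_add_sq_mem _
  have pos : ∀ c : ℝ, 0 < c → ι (C c) ∈ DressD := by
    intro c h0
    obtain ⟨n, hn⟩ := exists_nat_ge c
    have hn0 : (0 : ℝ) < n := h0.trans_le hn
    have h1 := mul_mem (natCast_mem DressD n) (key (c / n) (by positivity) ((div_le_one hn0).2 hn))
    rwa [← map_natCast ι, ← C_eq_natCast, ← map_mul, ← map_mul, mul_div_cancel₀ _ hn0.ne'] at h1
  rcases lt_trichotomy c 0 with h | rfl | h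
  · simpa using neg_mem (pos (-c) (by linarith))
  · simp
  · exact pos c h

theorem div_one_add_sq_mem {x : RatFunc ℝ} (hx : 1 + x ^ 2 ≠ 0) : x / (1 + x ^ 2) ∈ DressD := by
  have half : (2 : RatFunc ℝ)⁻¹ ∈ DressD := by
    have := inv_one_add_sq_mem 1
    norm_num at this
    simpa using this
  by_cases h : 1 + x = 0
  · obtain rfl : x = -1 := by linear_combination h
    convert neg_mem half using 1
    norm_num
  · have h1 := sub_mem (inv_one_add_sq_mem ((1 - x) / (1 + x))) half
    convert h1 using 1
    have h2 : (1 + x) ^ 2 + (1 - x) ^ 2 ≠ 0 := by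
      have : (1 + x) ^ 2 + (1 - x) ^ 2 = 2 * (1 + x ^ 2) := by ring
      rw [this]
      exact mul_ne_zero two_ne_zero hx
    have h3 : 1 + ((1 - x) / (1 + x)) ^ 2 ≠ 0 := by
      rw [div_pow, one_add_div (pow_ne_zero 2 h)]
      exact div_ne_zero h2 (pow_ne_zero 2 h)
    have h4 : 1 + ((1 - x) / (1 + x)) ^ 2 = 2 * (1 + x ^ 2) / (1 + x) ^ 2 := by
      field_simp; ring
    rw [h4]
    field_simp
    ring

theorem algebraMap_ne_zero_of_eval_ne_zero {f : ℝ[X]} {u : ℝ} (h : f.eval u ≠ 0) : ι f ≠ 0 := by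
  rw [Ne, map_eq_zero_iff _ (RatFunc.algebraMap_injective ℝ)]
  rintro rfl
  simp at h

theorem div_quadratic_mem (a : ℝ) {b : ℝ} (hb : b ≠ 0) {f : ℝ[X]} (hf : f.degree ≤ 2) :
    ι f / ι ((X - C a) ^ 2 + C b ^ 2) ∈ DressD := by
  have hb' : ι (C b) ≠ 0 := algebraMap_ne_zero_of_eval_ne_zero (u := 0) (by simpa using hb)
  have hq : ι ((X - C a) ^ 2 + C b ^ 2) ≠ 0 :=
    algebraMap_ne_zero_of_eval_ne_zero (u := a) (by simpa using hb)
  set x : RatFunc ℝ := (ι X - ι (C a)) / ι (C b) with hx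
  have hX : ι X = ι (C b) * x + ι (C a) := by rw [hx]; field_simp; ring
  have hQ : ι ((X - C a) ^ 2 + C b ^ 2) = ι (C b) ^ 2 * (1 + x ^ 2) := by
    rw [hx]; simp only [map_add, map_pow, map_sub]; field_simp; ring
  have hx0 : 1 + x ^ 2 ≠ 0 := fun h => hq (by rw [hQ, h, mul_zero])
  have hbi : (ι (C b))⁻¹ ∈ DressD := by
    have : (ι (C b))⁻¹ = ι (C b⁻¹) := by
      apply inv_eq_of_mul_eq_one_right
      rw [← map_mul, ← map_mul, mul_inv_cancel₀ hb, C_1, map_one]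
    exact this ▸ algebraMap_C_mem _
  have m0 := inv_one_add_sq_mem x
  have m1 := div_one_add_sq_mem hx0
  have m2 : x ^ 2 / (1 + x ^ 2) ∈ DressD := by
    have : x ^ 2 / (1 + x ^ 2) = 1 - (1 + x ^ 2)⁻¹ := by field_simp; ring
    exact this ▸ sub_mem (one_mem _) m0
  rw [eq_quadratic_of_degree_le_two hf]
  set c0 := f.coeff 0
  set c1 := f.coeff 1
  set c2 := f.coeff 2
  have e : ι (C c2 * X ^ 2 + C c1 * X + C c0) / ι ((X - C a) ^ 2 + C b ^ 2) =
      (ι (C b))⁻¹ ^ 2 * (ι (C c2) * (ι (C b) ^ 2 * (x ^ 2 / (1 + x ^ 2))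
        + 2 * ι (C a) * ι (C b) * (x / (1 + x ^ 2)) + ι (C a) ^ 2 * (1 + x ^ 2)⁻¹)
        + ι (C c1) * (ι (C b) * (x / (1 + x ^ 2)) + ι (C a) * (1 + x ^ 2)⁻¹)
        + ι (C c0) * (1 + x ^ 2)⁻¹) := by
    rw [hQ]
    simp only [map_add, map_mul, map_pow, hX]
    field_simp
    ring
  rw [e]
  have hC := algebraMap_C_mem
  have h2 : (2 : RatFunc ℝ) ∈ DressD := by exact_mod_cast natCast_mem DressD 2
  exact mul_mem (pow_mem hbi 2) (add_mem (add_mem (mul_mem (hC _) (add_mem (add_mem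
    (mul_mem (pow_mem (hC _) 2) m2) (mul_mem (mul_mem (mul_mem h2 (hC _)) (hC _)) m1))
    (mul_mem (pow_mem (hC _) 2) m0))) (mul_mem (hC _) (add_mem (mul_mem (hC _) m1)
    (mul_mem (hC _) m0)))) (mul_mem (hC _) m0))

theorem exists_eq_sub_sq_add_sq {g : ℝ[X]} (hg : IsMonicOfDegree g 2) (hr : ∀ u, g.eval u ≠ 0) :
    ∃ a b : ℝ, b ≠ 0 ∧ g = (X - C a) ^ 2 + C b ^ 2 := by
  obtain ⟨r, s, rfl⟩ := isMonicOfDegree_two_iff.1 hg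
  have hpos : 0 < s - r ^ 2 / 4 := by
    by_contra! h
    refine hr (-r / 2 + √(r ^ 2 / 4 - s)) ?_
    have := Real.sq_sqrt (show 0 ≤ r ^ 2 / 4 - s by linarith)
    simp only [eval_add, eval_pow, eval_X, eval_mul, eval_C]
    linear_combination this
  refine ⟨-r / 2, √(s - r ^ 2 / 4), (Real.sqrt_pos.2 hpos).ne', ?_⟩
  rw [← C_pow, Real.sq_sqrt hpos.le]
  have h1 : C r = 2 * C (r / 2) := by
    rw [← C_ofNat, ← C_mul]; congr 1; ring
  have h2 : C (r ^ 2 / 4) = C (r / 2) ^ 2 := by rw [← C_pow]; congr 1; ring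
  rw [C_sub, h2, neg_div, C_neg, h1]
  ring

theorem div_mem_of_isMonicOfDegree (n : ℕ) : ∀ f g : ℝ[X], IsMonicOfDegree g n →
    (∀ u, g.eval u ≠ 0) → f.degree ≤ g.degree → ι f / ι g ∈ DressD := by
  induction n using Nat.strong_induction_on with
  | _ n ih =>
    intro f g hg hr hd
    match n, hg with
    | 0, hg =>
      rw [isMonicOfDegree_zero_iff] at hg
      subst hg
      rw [degree_one] at hd
      rw [eq_C_of_degree_le_zero hd, map_one, div_one]
      exact algebraMap_C_mem _
    | 1, hg =>
      obtain ⟨r, rfl⟩ := isMonicOfDegree_one_iff.1 hg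
      exact absurd (by simp) (hr (-r))
    | m + 2, hg =>
      obtain ⟨g₁, g₂, h₁, h₂, rfl⟩ := hg.eq_isMonicOfDegree_two_mul_isMonicOfDegree
      have hr₁ : ∀ u, g₁.eval u ≠ 0 := fun u h => hr u (by rw [eval_mul, h, zero_mul])
      have hr₂ : ∀ u, g₂.eval u ≠ 0 := fun u h => hr u (by rw [eval_mul, h, mul_zero])
      have hd₁ : g₁.degree = 2 := by
        rw [degree_eq_natDegree h₁.ne_zero, h₁.natDegree_eq]; rfl
      have hz₁ := algebraMap_ne_zero_of_eval_ne_zero (hr₁ 0)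
      have hz₂ := algebraMap_ne_zero_of_eval_ne_zero (hr₂ 0)
      have hmod : (f % g₂).degree < g₂.degree := degree_mod_lt f h₂.ne_zero
      have hdiv : (f / g₂).degree ≤ 2 := by
        by_cases hlt : f.degree < g₂.degree
        · rw [(Polynomial.div_eq_zero_iff h₂.ne_zero).2 hlt]
          simp
        · have := degree_add_div h₂.ne_zero (not_lt.1 hlt)
          rw [← this, degree_mul, add_comm, hd₁] at hd
          exact (WithBot.add_le_add_iff_right (degree_ne_bot.2 h₂.ne_zero)).1 hd
      obtain ⟨a, b, hb, rfl⟩ := exists_eq_sub_sq_add_sq h₁ hr₁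
      have e : ι f / ι (((X - C a) ^ 2 + C b ^ 2) * g₂) = ι (f / g₂) / ι ((X - C a) ^ 2 + C b ^ 2)
          + ι 1 / ι ((X - C a) ^ 2 + C b ^ 2) * (ι (f % g₂) / ι g₂) := by
        conv_lhs => rw [← EuclideanDomain.div_add_mod f g₂]
        rw [map_mul, map_add, map_mul, map_one]
        field_simp
      rw [e]
      exact add_mem (div_quadratic_mem a hb hdiv) (mul_mem
        (div_quadratic_mem a hb (by rw [degree_one]; norm_num))
        (ih m (by omega) _ _ h₂ hr₂ hmod.le))

theorem div_mem {f g : ℝ[X]} (hr : ∀ u, g.eval u ≠ 0) (hd : f.degree ≤ g.degree) :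
    ι f / ι g ∈ DressD := by
  have hg : g ≠ 0 := by rintro rfl; simp at hr
  have hlc : g.leadingCoeff⁻¹ ≠ 0 := inv_ne_zero (leadingCoeff_ne_zero.2 hg)
  have hz := algebraMap_ne_zero_of_eval_ne_zero (hr 0)
  have hc : ι (C g.leadingCoeff⁻¹) ≠ 0 :=
    algebraMap_ne_zero_of_eval_ne_zero (u := 0) (by simpa using hg)
  have hm : (g * C g.leadingCoeff⁻¹).Monic := monic_mul_leadingCoeff_inv hg
  have h := div_mem_of_isMonicOfDegree _ (f * C g.leadingCoeff⁻¹) (g * C g.leadingCoeff⁻¹)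
    ⟨rfl, hm⟩ (fun u => by simpa using ⟨hr u, hg⟩)
    (by rwa [degree_mul_C hlc, degree_mul_C hlc])
  rwa [map_mul, map_mul, mul_div_mul_right _ _ hc] at h

theorem leadingCoeff_nonneg_of_eval_nonneg {f : ℝ[X]} (hf : ∀ u, 0 ≤ f.eval u) :
    0 ≤ f.leadingCoeff := by
  by_contra! h
  by_cases hd : 0 < f.degree
  · have ht := f.tendsto_atBot_of_leadingCoeff_nonpos hd h.le
    obtain ⟨u, hu⟩ := (ht.eventually_lt_atBot 0).exists
    exact absurd (hf u) (not_le.2 hu)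
  · rw [eq_C_of_degree_le_zero (not_lt.1 hd)] at h hf
    have := hf 0
    simp at h this
    linarith

theorem degree_le_degree_add_of_eval_nonneg {f g : ℝ[X]} (hf : ∀ u, 0 ≤ f.eval u)
    (hg : ∀ u, 0 ≤ g.eval u) : g.degree ≤ (f + g).degree := by
  have h1 := leadingCoeff_nonneg_of_eval_nonneg hf
  have h2 := leadingCoeff_nonneg_of_eval_nonneg hg
  by_cases h : f.leadingCoeff + g.leadingCoeff = 0
  · have : g.leadingCoeff = 0 := by linarith
    rw [leadingCoeff_eq_zero.1 this]
    simp
  · rw [degree_add_eq_of_leadingCoeff_add_ne_zero h]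
    exact le_max_right _ _

theorem exists_eq_div_of_mem {z : RatFunc ℝ} (hz : z ∈ DressD) :
    ∃ f g : ℝ[X], (∀ u, 0 < g.eval u) ∧ f.degree ≤ g.degree ∧ z = ι f / ι g := by
  induction hz using Subring.closure_induction with
  | mem z hz =>
    obtain ⟨x, rfl⟩ := hz
    have hpos : ∀ u, 0 < (x.num ^ 2 + x.denom ^ 2).eval u := by
      intro u
      obtain ⟨a, b, hab⟩ := x.isCoprime_num_denom
      have := congrArg (eval u) hab
      simp only [eval_add, eval_mul, eval_one, eval_pow] at this ⊢
      by_contra! h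
      have h1 : x.num.eval u = 0 := by
        nlinarith [sq_nonneg (x.num.eval u), sq_nonneg (x.denom.eval u)]
      have h2 : x.denom.eval u = 0 := by
        nlinarith [sq_nonneg (x.num.eval u), sq_nonneg (x.denom.eval u)]
      rw [h1, h2] at this
      simp at this
    refine ⟨x.denom ^ 2, x.num ^ 2 + x.denom ^ 2, hpos,
      degree_le_degree_add_of_eval_nonneg (fun u => ?_) fun u => ?_, ?_⟩
    · rw [eval_pow]; positivity
    · rw [eval_pow]; positivity
    · have hd : ι x.denom ≠ 0 := by simpa using x.denom_ne_zero
      have h0 := algebraMap_ne_zero_of_eval_ne_zero (hpos 0).ne'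
      rw [map_add, map_pow, map_pow] at h0 ⊢
      conv_lhs => rw [← x.num_div_denom]
      rw [div_pow, one_add_div (pow_ne_zero 2 hd), inv_div, add_comm]
  | zero => exact ⟨0, 1, by simp, by simp, by simp⟩
  | one => exact ⟨1, 1, by simp, by simp, by simp⟩
  | add x y _ _ hx hy =>
    obtain ⟨f, g, hg, hd, rfl⟩ := hx
    obtain ⟨f', g', hg', hd', rfl⟩ := hy
    refine ⟨f * g' + g * f', g * g', fun u => by simpa using mul_pos (hg u) (hg' u), ?_, ?_⟩
    · refine (degree_add_le _ _).trans (max_le ?_ ?_) <;> rw [degree_mul, degree_mul] <;> gcongr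
    · have := algebraMap_ne_zero_of_eval_ne_zero (hg 0).ne'
      have := algebraMap_ne_zero_of_eval_ne_zero (hg' 0).ne'
      simp only [map_add, map_mul]
      field_simp
  | neg x _ hx =>
    obtain ⟨f, g, hg, hd, rfl⟩ := hx
    exact ⟨-f, g, hg, by rwa [degree_neg], by rw [map_neg, neg_div]⟩
  | mul x y _ _ hx hy =>
    obtain ⟨f, g, hg, hd, rfl⟩ := hx
    obtain ⟨f', g', hg', hd', rfl⟩ := hy
    refine ⟨f * f', g * g', fun u => by simpa using mul_pos (hg u) (hg' u), ?_, ?_⟩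
    · rw [degree_mul, degree_mul]; gcongr
    · rw [map_mul, map_mul, div_mul_div_comm]

theorem eval_div_algebraMap (f : ℝ[X]) {g : ℝ[X]} {u : ℝ} (hg : g.eval u ≠ 0) :
    RatFunc.eval (RingHom.id ℝ) u (ι f / ι g) = f.eval u / g.eval u := by
  have hg0 : g ≠ 0 := by rintro rfl; simp at hg
  have hd : (ι f / ι g).denom.eval u ≠ 0 := fun h =>
    hg (eval_eq_zero_of_dvd_of_eval_eq_zero (RatFunc.denom_div_dvd f g) h)
  have h := congrArg (eval u) ((RatFunc.num_mul_eq_mul_denom_iff (x := ι f / ι g) hg0).2 rfl)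
  rw [eval_mul, eval_mul] at h
  rw [RatFunc.eval, eval₂_id, eval₂_id, div_eq_div_iff hd hg, h]

theorem eval_X_sq_add_one_pow_pos (n : ℕ) (u : ℝ) : 0 < ((X ^ 2 + 1 : ℝ[X]) ^ n).eval u := by
  simp only [eval_pow, eval_add, eval_X, eval_one]
  positivity

theorem natDegree_X_sq_add_one_pow (n : ℕ) : ((X ^ 2 + 1 : ℝ[X]) ^ n).natDegree = 2 * n := by
  have : (X ^ 2 + 1 : ℝ[X]).natDegree = 2 := by compute_degree!
  rw [natDegree_pow, this, mul_comm]

theorem div_mem_of_natDegree_le {f g : ℝ[X]} (hr : ∀ u, g.eval u ≠ 0)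
    (hd : f.natDegree ≤ g.natDegree) : ι f / ι g ∈ DressD :=
  div_mem hr <| degree_le_natDegree.trans <| by
    rw [degree_eq_natDegree (p := g) (by rintro rfl; simp at hr)]
    exact_mod_cast hd

theorem row_isProductOfIdempotents_of_dvd {s q : DressD} (h : s ∣ q) :
    IsProductOfIdempotents (!![s, q; 0, 0] : Matrix (Fin 2) (Fin 2) DressD) := by
  obtain ⟨x, rfl⟩ := h
  apply row_add_mul_snd_isProductOfIdempotents (-x)
  rw [show s * x + -x * s = 0 by ring]
  exact row_isProductOfIdempotents_of_snd_eq_zero s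

/-- The row `(1 / (1 + X²), X / (1 + X²))` is the first row of an orthogonal projection. -/
theorem row_circle_isProductOfIdempotents {t r : DressD}
    (ht : (t : RatFunc ℝ) = ι 1 / ι (X ^ 2 + 1)) (hr : (r : RatFunc ℝ) = ι X / ι (X ^ 2 + 1)) :
    IsProductOfIdempotents (!![t, r; 0, 0] : Matrix (Fin 2) (Fin 2) DressD) := by
  have h : r * r = t * (1 - t) := by
    have h0 : ι (X ^ 2 + 1) ≠ 0 :=
      algebraMap_ne_zero_of_eval_ne_zero (u := 0) (by simp)
    apply Subtype.ext
    push_cast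
    rw [ht, hr]
    field_simp
    simp only [map_add, map_pow, map_one]
    ring
  apply row_isProductOfIdempotents_of_idempotent (c := r) (d := 1 - t)
  unfold IsIdempotentElem
  ext i j
  fin_cases i <;> fin_cases j <;> simp [h] <;> ring

theorem row_isProductOfIdempotents_of_odd_natDegree {s q : DressD} {σ g γ : ℝ[X]} {k : ℕ}
    (hγ : ∀ u, 0 < γ.eval u) (hσ : ∀ u, σ.eval u ≠ 0) (hσd : σ.natDegree = 4 * k + 2)
    (hgd : g.natDegree = 2 * k + 1) (hγd : 2 * k + 2 ≤ γ.natDegree)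
    (hs : (s : RatFunc ℝ) = ι σ / (ι γ * ι ((X ^ 2 + 1) ^ (k + 1))))
    (hq : (q : RatFunc ℝ) = ι g / ι γ) :
    IsProductOfIdempotents (!![s, q; 0, 0] : Matrix (Fin 2) (Fin 2) DressD) := by
  have hω : ∀ n : ℕ, ∀ u, ((X ^ 2 + 1 : ℝ[X]) ^ n).eval u ≠ 0 := fun n u =>
    (eval_X_sq_add_one_pow_pos n u).ne'
  have hω1 : ∀ u, (X ^ 2 + 1 : ℝ[X]).eval u ≠ 0 := fun u => by simpa using hω 1 u
  have hωd := natDegree_X_sq_add_one_pow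
  have hω1d : (X ^ 2 + 1 : ℝ[X]).natDegree = 2 := by simpa using hωd 1
  have hγ0 := algebraMap_ne_zero_of_eval_ne_zero (hγ 0).ne'
  have hσ0 := algebraMap_ne_zero_of_eval_ne_zero (hσ 0)
  have hω0 := algebraMap_ne_zero_of_eval_ne_zero (hω1 0)
  have hc : g.leadingCoeff ≠ 0 := by
    rw [leadingCoeff_ne_zero]
    rintro rfl
    simp at hgd
  have hc0 : ι (C g.leadingCoeff) ≠ 0 :=
    algebraMap_ne_zero_of_eval_ne_zero (u := 0) (by simpa using hc)
  set d : ℝ[X] := g - C g.leadingCoeff * (X * (X ^ 2 + 1) ^ k) with hd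
  have hdd : d.natDegree ≤ 2 * k := by
    have hm : (X * (X ^ 2 + 1) ^ k : ℝ[X]).Monic :=
      monic_X.mul (Monic.pow (by monicity!) k)
    have hmd : (X * (X ^ 2 + 1) ^ k : ℝ[X]).natDegree = 2 * k + 1 := by
      rw [natDegree_X_mul (pow_ne_zero k (by intro h; simp [h] at hω1)), hωd]
    have hg0 : g ≠ 0 := leadingCoeff_ne_zero.1 hc
    have hlt : d.degree < g.degree := by
      refine degree_sub_lt_left ?_ hg0 ?_
      · rw [degree_C_mul hc, degree_eq_natDegree hg0, degree_eq_natDegree hm.ne_zero, hmd, hgd]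
      · rw [leadingCoeff_mul, leadingCoeff_C, hm.leadingCoeff, mul_one]
    by_cases hd0 : d = 0
    · simp [hd0]
    · have := natDegree_lt_natDegree hd0 hlt
      omega
  have hω0' := algebraMap_ne_zero_of_eval_ne_zero (hω (2 * k + 1) 0)
  have hinv : ∀ {a b : RatFunc ℝ}, a ≠ 0 → b ≠ 0 → a / b * (b / a) = 1 := fun ha hb => by
    field_simp
  let v : DressDˣ :=
    { val := ⟨ι σ / ι ((X ^ 2 + 1) ^ (2 * k + 1)),
        div_mem_of_natDegree_le (hω _) (by rw [hωd]; omega)⟩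
      inv := ⟨ι ((X ^ 2 + 1) ^ (2 * k + 1)) / ι σ,
        div_mem_of_natDegree_le hσ (by rw [hωd]; omega)⟩
      val_inv := Subtype.ext (hinv hσ0 hω0')
      inv_val := Subtype.ext (hinv hω0' hσ0) }
  let c : DressDˣ :=
    { val := ⟨ι (C g.leadingCoeff), algebraMap_C_mem _⟩
      inv := ⟨ι (C g.leadingCoeff⁻¹), algebraMap_C_mem _⟩
      val_inv := by
        apply Subtype.ext
        push_cast
        rw [← map_mul, ← map_mul, mul_inv_cancel₀ hc, C_1, map_one]
      inv_val := by
        apply Subtype.ext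
        push_cast
        rw [← map_mul, ← map_mul, inv_mul_cancel₀ hc, C_1, map_one] }
  let t : DressD := ⟨ι 1 / ι (X ^ 2 + 1), div_mem_of_natDegree_le hω1 (by simp)⟩
  let r : DressD := ⟨ι X / ι (X ^ 2 + 1), div_mem_of_natDegree_le hω1 (by simp [hω1d])⟩
  let d' : DressD := ⟨ι d / ι ((X ^ 2 + 1) ^ k),
    div_mem_of_natDegree_le (hω _) (by rwa [hωd])⟩
  let y : DressD := ⟨ι ((X ^ 2 + 1) ^ (k + 1)) / ι γ,
    div_mem_of_natDegree_le (fun u => (hγ u).ne') (by rw [hωd]; omega)⟩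
  have hsy : s = y * (v * t) := by
    apply Subtype.ext
    simp only [Subring.coe_mul, y, v, t, hs, map_pow, map_one]
    field_simp
    ring
  have hqy : q = y * (c * r + d' * t) := by
    apply Subtype.ext
    simp only [Subring.coe_mul, Subring.coe_add, y, c, r, d', t, hq, hd, map_pow, map_sub,
      map_mul, map_one]
    field_simp
    ring
  rw [hsy, hqy]
  apply row_smul_isProductOfIdempotents
  apply row_add_mul_snd_isProductOfIdempotents (-(d' * (v⁻¹ : DressDˣ)))
  rw [show (c : DressD) * r + d' * t + -(d' * (v⁻¹ : DressDˣ)) * (v * t) = c * r by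
    linear_combination (-(d' * t)) * v.inv_mul]
  exact row_units_mul_isProductOfIdempotents v c (row_circle_isProductOfIdempotents rfl rfl)

theorem row_isProductOfIdempotents_of_eval_nonpos {p q : DressD} {f g γ : ℝ[X]} {n : ℕ}
    (hγ : ∀ u, 0 < γ.eval u) (hγd : γ.natDegree = 2 * n) (hgd : g.natDegree ≤ γ.natDegree)
    (hp : (p : RatFunc ℝ) = ι f / ι γ) (hq : (q : RatFunc ℝ) = ι g / ι γ)
    (hf : ∀ u, f.eval u ≤ 0) (hfg : ∀ u, f.eval u = 0 → g.eval u ≠ 0) :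
    IsProductOfIdempotents (!![p, q; 0, 0] : Matrix (Fin 2) (Fin 2) DressD) := by
  by_cases hg0 : g = 0
  · obtain rfl : q = 0 := Subtype.ext (by simp [hq, hg0])
    exact row_isProductOfIdempotents_of_snd_eq_zero p
  have hω : ∀ n : ℕ, ∀ u, 0 < ((X ^ 2 + 1 : ℝ[X]) ^ n).eval u := eval_X_sq_add_one_pow_pos
  have hωd := natDegree_X_sq_add_one_pow
  have hγ0 := algebraMap_ne_zero_of_eval_ne_zero (hγ 0).ne'
  have hneg : ∀ (e : ℕ) u, (f * (X ^ 2 + 1) ^ e - g ^ 2).eval u < 0 := by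
    intro e u
    have h1 := hω e u
    rw [eval_sub, eval_mul, eval_pow (p := g)]
    rcases (hf u).lt_or_eq with h | h
    · nlinarith [sq_nonneg (g.eval u), mul_neg_of_neg_of_pos h h1]
    · have := pow_pos (abs_pos.2 (hfg u h)) 2
      rw [sq_abs] at this
      rw [h]
      linarith
  have hdeg : ∀ e : ℕ, 2 * g.natDegree ≤ (f * (X ^ 2 + 1) ^ e - g ^ 2).natDegree := by
    intro e
    rw [← natDegree_pow, ← natDegree_neg (f * (X ^ 2 + 1) ^ e - g ^ 2), neg_sub, sub_eq_neg_add]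
    apply natDegree_le_natDegree
    apply degree_le_degree_add_of_eval_nonneg
    · intro u
      rw [eval_neg, eval_mul]
      nlinarith [hf u, hω e u]
    · intro u
      rw [eval_pow]
      positivity
  have reduce : ∀ e : ℕ, g.natDegree ≤ 2 * e → (∀ s : DressD,
      (s : RatFunc ℝ) = ι (f * (X ^ 2 + 1) ^ e - g ^ 2) / (ι γ * ι ((X ^ 2 + 1) ^ e)) →
      IsProductOfIdempotents (!![s, q; 0, 0] : Matrix (Fin 2) (Fin 2) DressD)) →
      IsProductOfIdempotents (!![p, q; 0, 0] : Matrix (Fin 2) (Fin 2) DressD) := by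
    intro e he h
    have hω0 := algebraMap_ne_zero_of_eval_ne_zero (hω e 0).ne'
    apply row_add_mul_fst_isProductOfIdempotents
      (-⟨ι g / ι ((X ^ 2 + 1) ^ e), div_mem_of_natDegree_le (fun u => (hω e u).ne')
        (by rwa [hωd])⟩)
    apply h
    simp only [Subring.coe_mul, Subring.coe_add, Subring.coe_neg, hp, hq]
    rw [map_sub, map_mul, map_pow ι g]
    field_simp
    ring
  have divides : ∀ e : ℕ, g.natDegree + 2 * e ≤ (f * (X ^ 2 + 1) ^ e - g ^ 2).natDegree →
      ∀ s : DressD,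
      (s : RatFunc ℝ) = ι (f * (X ^ 2 + 1) ^ e - g ^ 2) / (ι γ * ι ((X ^ 2 + 1) ^ e)) →
      IsProductOfIdempotents (!![s, q; 0, 0] : Matrix (Fin 2) (Fin 2) DressD) := by
    intro e he s hs
    have hω0 := algebraMap_ne_zero_of_eval_ne_zero (hω e 0).ne'
    have hσ0 := algebraMap_ne_zero_of_eval_ne_zero (hneg e 0).ne
    refine row_isProductOfIdempotents_of_dvd
      ⟨⟨ι (g * (X ^ 2 + 1) ^ e) / ι (f * (X ^ 2 + 1) ^ e - g ^ 2),
        div_mem_of_natDegree_le (fun u => (hneg e u).ne) ?_⟩, Subtype.ext ?_⟩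
    · exact natDegree_mul_le.trans (by rwa [hωd])
    · simp only [Subring.coe_mul, hs, hq, map_mul]
      field_simp
  obtain ⟨k, hk | hk⟩ := g.natDegree.even_or_odd'
  · exact reduce k hk.le (divides k (by have := hdeg k; omega))
  · refine reduce (k + 1) (by omega) ?_
    by_cases h : g.natDegree + 2 * (k + 1) ≤ (f * (X ^ 2 + 1) ^ (k + 1) - g ^ 2).natDegree
    · exact divides (k + 1) h
    · intro s hs
      have := hdeg (k + 1)
      exact row_isProductOfIdempotents_of_odd_natDegree hγ (fun u => (hneg (k + 1) u).ne)
        (by omega) hk (by omega) hs hq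

theorem row_isProductOfIdempotents_of_evalD_nonpos (p q : DressD)
    (hcomax : ¬∃ u : ℝ, evalD p u = 0 ∧ evalD q u = 0) (hneg : ∀ u : ℝ, evalD p u ≤ 0) :
    IsProductOfIdempotents (!![p, q; 0, 0] : Matrix (Fin 2) (Fin 2) DressD) := by
  obtain ⟨f, γ, hγ, -, hp⟩ := exists_eq_div_of_mem p.2
  obtain ⟨g, δ, hδ, hd, hq⟩ := exists_eq_div_of_mem q.2
  have hγ0 := algebraMap_ne_zero_of_eval_ne_zero (hγ 0).ne'
  have hδ0 := algebraMap_ne_zero_of_eval_ne_zero (hδ 0).ne'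
  have hpe : ∀ u, evalD p u = f.eval u / γ.eval u := fun u => by
    rw [evalD, hp, eval_div_algebraMap f (hγ u).ne']
  have hqe : ∀ u, evalD q u = g.eval u / δ.eval u := fun u => by
    rw [evalD, hq, eval_div_algebraMap g (hδ u).ne']
  have hf : ∀ u, f.eval u ≤ 0 := fun u => by
    have := hneg u
    rw [hpe] at this
    simpa using (div_le_iff₀ (hγ u)).1 this
  refine row_isProductOfIdempotents_of_eval_nonpos (f := f * γ * δ ^ 2) (g := g * γ ^ 2 * δ)
    (γ := (γ * δ) ^ 2) (n := (γ * δ).natDegree) ?_ (natDegree_pow _ _) ?_ ?_ ?_ ?_ ?_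
  · intro u
    rw [eval_pow, eval_mul]
    exact pow_pos (mul_pos (hγ u) (hδ u)) 2
  · apply natDegree_le_natDegree
    rw [show (γ * δ) ^ 2 = δ * γ ^ 2 * δ by ring]
    simp only [degree_mul]
    gcongr
  · rw [hp]
    simp only [map_mul, map_pow]
    field_simp
  · rw [hq]
    simp only [map_mul, map_pow]
    field_simp
  · intro u
    simp only [eval_mul, eval_pow]
    exact mul_nonpos_of_nonpos_of_nonneg
      (mul_nonpos_of_nonpos_of_nonneg (hf u) (hγ u).le) (sq_nonneg _)
  · intro u h h'
    refine hcomax ⟨u, ?_, ?_⟩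
    · simpa [hpe, (hγ u).ne', (hδ u).ne'] using h
    · simpa [hqe, (hγ u).ne', (hδ u).ne'] using h'

end Membership

end DressRing

theorem stmt_7 (p q : DressD)
    (hcomax : ¬∃ u : ℝ, evalD p u = 0 ∧ evalD q u = 0)
    (hneg : (∀ u : ℝ, evalD p u ≤ 0) ∨ (∀ u : ℝ, evalD q u ≤ 0)) :
    IsProductOfIdempotents (!![p, q; 0, 0] : Matrix (Fin 2) (Fin 2) DressD) := by
  rcases hneg with h | h
  · exact DressRing.row_isProductOfIdempotents_of_evalD_nonpos p q hcomax h
  · exact DressRing.row_swap_isProductOfIdempotents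
      (DressRing.row_isProductOfIdempotents_of_evalD_nonpos q p
        (fun ⟨u, hu⟩ => hcomax ⟨u, hu.symm⟩) h)
end

section
/- Let x, y ∈ ℝ[X], let ε > 0 be a real number and k ≥ 1 an integer, and assume: (i) 0 is the unique real root of y and it has multiplicity k (rootMultiplicity y 0 = k); (ii) x(0) ≠ 0; (iii) for every i with 0 ≤ i ≤ k−1, the i-th derivative satisfies y⁽ⁱ⁾(t) > 0 for all t ∈ (0, ε]; (iv) y⁽ᵏ⁾ does not change sign on (0, ε]; (v) for every j with 0 ≤ j ≤ k, x⁽ʲ⁾ does not change sign on (0, ε]. Then there exists a real number r₀ > 0 such that for every r with 0 < r ≤ r₀ the polynomial r·x + y has at most one root in (0, ε], and if moreover x(t) < 0 for all t ∈ (0, ε], then r·x + y has exactly one root in (0, ε]. -/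
open Polynomial

/-- If `0` is a root of `y ≠ 0` but not of `x`, then the numerator of the derivative
of `y / x` does not vanish identically. -/
theorem derivative_mul_sub_mul_derivative_ne_zero {x y : ℝ[X]} (hy : y ≠ 0)
    (hy0 : y.eval 0 = 0) (hx0 : x.eval 0 ≠ 0) :
    derivative y * x - y * derivative x ≠ 0 := by
  intro h
  have h := sub_eq_zero.mp h
  have hx : x ≠ 0 := by rintro rfl; simp at hx0
  have hy' : derivative y ≠ 0 := by
    intro hd
    have hc := eq_C_of_derivative_eq_zero hd
    apply hy
    rw [hc, coeff_zero_eq_eval_zero, hy0, C_0]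
  have hl : derivative y * x ≠ 0 := mul_ne_zero hy' hx
  have hr : y * derivative x ≠ 0 := h ▸ hl
  have hm := congrArg (rootMultiplicity 0) h
  rw [rootMultiplicity_mul hl, rootMultiplicity_mul hr,
    derivative_rootMultiplicity_of_root (p := y) hy0,
    rootMultiplicity_eq_zero (p := x) hx0] at hm
  have hpos := (rootMultiplicity_pos hy).mpr (show IsRoot y 0 from hy0)
  omega

/-- A nonzero real polynomial has no root in a sufficiently small interval `(0, δ]`. -/
theorem exists_Ioc_eval_ne_zero {p : ℝ[X]} (hp : p ≠ 0) {ε : ℝ} (hε : 0 < ε) :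
    ∃ δ, 0 < δ ∧ δ ≤ ε ∧ ∀ t ∈ Set.Ioc 0 δ, p.eval t ≠ 0 := by
  have hfin : ({t : ℝ | IsRoot p t} \ {0}).Finite :=
    (finite_setOfPred_isRoot hp).subset Set.sdiff_subset
  have hnhds := hfin.isClosed.isOpen_compl.mem_nhds
    (show (0 : ℝ) ∈ ({t : ℝ | IsRoot p t} \ {0})ᶜ by simp)
  obtain ⟨η, hη, hball⟩ := Metric.mem_nhds_iff.mp hnhds
  refine ⟨min (η / 2) ε, lt_min (by linarith) hε, min_le_right _ _, fun t ht h => ?_⟩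
  have hlt : t ≤ η / 2 := ht.2.trans (min_le_left _ _)
  have hmem : t ∈ Metric.ball (0 : ℝ) η := by
    rw [Metric.mem_ball, Real.dist_eq, sub_zero, abs_of_pos ht.1]
    linarith
  exact hball hmem ⟨h, ht.1.ne'⟩

/-- If neither `x` nor the numerator of the derivative of `y / x` vanishes on `[a, b]`, then
`r x + y` does not vanish at both endpoints, by Rolle's theorem applied to `y / x`. -/
theorem not_both_root_of_ne_zero {x y : ℝ[X]} {r a b : ℝ} (hab : a < b)
    (hx : ∀ t ∈ Set.Icc a b, x.eval t ≠ 0)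
    (hw : ∀ t ∈ Set.Icc a b, (derivative y * x - y * derivative x).eval t ≠ 0)
    (ha : (C r * x + y).eval a = 0) (hb : (C r * x + y).eval b = 0) : False := by
  have hval : ∀ t ∈ Set.Icc a b, (C r * x + y).eval t = 0 → y.eval t / x.eval t = -r := by
    intro t ht h
    rw [div_eq_iff (hx t ht)]
    simp only [eval_add, eval_mul, eval_C] at h
    linarith
  obtain ⟨c, hc, hc0⟩ := exists_hasDerivAt_eq_zero (f := fun t => y.eval t / x.eval t) hab
    (y.continuous.continuousOn.div x.continuous.continuousOn hx)
    ((hval a ⟨le_rfl, hab.le⟩ ha).trans (hval b ⟨hab.le, le_rfl⟩ hb).symm)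
    (fun t ht => (y.hasDerivAt t).div (x.hasDerivAt t) (hx t (Set.Ioo_subset_Icc_self ht)))
  have hcI := Set.Ioo_subset_Icc_self hc
  apply hw c hcI
  rcases div_eq_zero_iff.mp hc0 with h | h
  · simpa using h
  · exact absurd h (pow_ne_zero 2 (hx c hcI))

/-- If `y` is positive on `[δ, ε]`, then so is `r x + y` for all sufficiently small `r > 0`. -/
theorem exists_pos_forall_eval_add_pos {x y : ℝ[X]} {δ ε : ℝ} (hδε : δ ≤ ε)
    (hy : ∀ t ∈ Set.Icc δ ε, 0 < y.eval t) :
    ∃ r₀ : ℝ, 0 < r₀ ∧ ∀ r : ℝ, 0 < r → r ≤ r₀ →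
      ∀ t ∈ Set.Icc δ ε, 0 < (C r * x + y).eval t := by
  have hne : (Set.Icc δ ε).Nonempty := Set.nonempty_Icc.mpr hδε
  obtain ⟨m, hm, hmin⟩ := isCompact_Icc.exists_isMinOn hne y.continuous.continuousOn
  obtain ⟨M, hM⟩ := isCompact_Icc.exists_bound_of_continuousOn (s := Set.Icc δ ε)
    x.continuous.continuousOn
  have hM0 : 0 ≤ M := (norm_nonneg _).trans (hM m hm)
  refine ⟨y.eval m / (M + 1), div_pos (hy m hm) (by linarith), fun r hr hle t ht => ?_⟩
  have h1 : r * (M + 1) ≤ y.eval m := (le_div_iff₀ (by linarith)).mp hle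
  have h2 : -M ≤ x.eval t := (abs_le.mp (hM t ht)).1
  have h3 : y.eval m ≤ y.eval t := hmin ht
  have h4 : r * -M ≤ r * x.eval t := mul_le_mul_of_nonneg_left h2 hr.le
  simp only [eval_add, eval_mul, eval_C]
  linarith

theorem stmt_8 (x y : Polynomial ℝ) (ε : ℝ) (hε : 0 < ε) (k : ℕ) (hk : 1 ≤ k)
    (hroot : {u : ℝ | y.eval u = 0} = {0}) (hmult : y.rootMultiplicity 0 = k)
    (hx0 : x.eval 0 ≠ 0)
    (hyder : ∀ i : ℕ, i ≤ k - 1 → ∀ t ∈ Set.Ioc (0 : ℝ) ε,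
      0 < ((Polynomial.derivative)^[i] y).eval t)
    (hyk : (∀ t ∈ Set.Ioc (0 : ℝ) ε, 0 ≤ ((Polynomial.derivative)^[k] y).eval t) ∨
           (∀ t ∈ Set.Ioc (0 : ℝ) ε, ((Polynomial.derivative)^[k] y).eval t ≤ 0))
    (hxder : ∀ j : ℕ, j ≤ k →
      (∀ t ∈ Set.Ioc (0 : ℝ) ε, 0 ≤ ((Polynomial.derivative)^[j] x).eval t) ∨
      (∀ t ∈ Set.Ioc (0 : ℝ) ε, ((Polynomial.derivative)^[j] x).eval t ≤ 0)) :
    ∃ r₀ : ℝ, 0 < r₀ ∧ ∀ r : ℝ, 0 < r → r ≤ r₀ →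
      ({t : ℝ | t ∈ Set.Ioc (0 : ℝ) ε ∧ (C r * x + y).eval t = 0}).Subsingleton ∧
      ((∀ t ∈ Set.Ioc (0 : ℝ) ε, x.eval t < 0) →
        ∃! t : ℝ, t ∈ Set.Ioc (0 : ℝ) ε ∧ (C r * x + y).eval t = 0) := by
  have hy0 : y.eval 0 = 0 := by
    have h : (0 : ℝ) ∈ {u : ℝ | y.eval u = 0} := hroot ▸ Set.mem_singleton 0
    exact h
  have hypos : ∀ t ∈ Set.Ioc (0 : ℝ) ε, 0 < y.eval t := hyder 0 (Nat.zero_le _)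
  have hy : y ≠ 0 := by
    rintro rfl
    simpa using hypos ε ⟨hε, le_rfl⟩
  have hx : x ≠ 0 := by
    rintro rfl
    simp at hx0
  obtain ⟨δ, hδ, hδε, hne⟩ := exists_Ioc_eval_ne_zero
    (mul_ne_zero (derivative_mul_sub_mul_derivative_ne_zero hy hy0 hx0) hx) hε
  simp only [eval_mul (q := x) (p := _ - _), mul_ne_zero_iff] at hne
  obtain ⟨r₀, hr₀, hpos⟩ := exists_pos_forall_eval_add_pos (x := x) hδε
    (fun t ht => hypos t ⟨hδ.trans_le ht.1, ht.2⟩)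
  refine ⟨r₀, hr₀, fun r hr hrle => ?_⟩
  have hposr := hpos r hr hrle
  have hlt : ∀ t ∈ Set.Ioc (0 : ℝ) ε, (C r * x + y).eval t = 0 → t < δ := by
    intro t ht h
    by_contra! hle
    exact (hposr t ⟨hle, ht.2⟩).ne' h
  have hle : ∀ a ∈ Set.Ioc (0 : ℝ) ε, ∀ b ∈ Set.Ioc (0 : ℝ) ε,
      (C r * x + y).eval a = 0 → (C r * x + y).eval b = 0 → b ≤ a := by
    intro a ha b hb ha0 hb0
    by_contra! hab
    have hsub : ∀ t ∈ Set.Icc a b, t ∈ Set.Ioc 0 δ := fun t ht =>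
      ⟨ha.1.trans_le ht.1, ht.2.trans (hlt b hb hb0).le⟩
    exact not_both_root_of_ne_zero hab (fun t ht => (hne t (hsub t ht)).2)
      (fun t ht => (hne t (hsub t ht)).1) ha0 hb0
  refine ⟨fun a ha b hb => le_antisymm (hle b hb.1 a ha.1 hb.2 ha.2)
    (hle a ha.1 b hb.1 ha.2 hb.2), fun hneg => ?_⟩
  have hx0neg : x.eval 0 < 0 := by
    refine lt_of_le_of_ne ?_ hx0
    refine le_of_tendsto (x.continuous.tendsto' 0 _ rfl |>.mono_left
      (nhdsWithin_le_nhds (s := Set.Ioi 0))) ?_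
    filter_upwards [Ioc_mem_nhdsGT hε] with t ht using (hneg t ht).le
  have h0 : (C r * x + y).eval 0 < 0 := by
    simpa [hy0] using mul_neg_of_pos_of_neg hr hx0neg
  obtain ⟨t, ht, ht0⟩ := intermediate_value_Ioo hε.le (C r * x + y).continuous.continuousOn
    ⟨h0, hposr ε ⟨hδε, le_rfl⟩⟩
  have htI := Set.Ioo_subset_Ioc_self ht
  exact ⟨t, ⟨htI, ht0⟩, fun s hs => le_antisymm (hle t htI s hs.1 ht0 hs.2)
    (hle s hs.1 t htI hs.2 ht0)⟩
end

section
/- Let x, y ∈ ℝ[X] be polynomials without common real roots such that deg x and deg y are odd, deg x > deg y, y has a unique real root, and there exist real roots x₁, x₂ of x with y(x₁)·y(x₂) < 0. Then there exists a nonzero real number r such that the polynomial r·x + y has a unique real root. -/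
open Polynomial

/-- A real polynomial of positive even degree with positive leading coefficient is positive
away from a bounded set. -/
theorem Polynomial.exists_forall_le_abs_eval_pos {q : ℝ[X]} (hdeg : q.natDegree ≠ 0)
    (heven : Even q.natDegree) (hlead : 0 < q.leadingCoeff) :
    ∃ M : ℝ, 0 < M ∧ ∀ u : ℝ, M ≤ |u| → 0 < q.eval u := by
  have hd : 0 < q.degree := natDegree_pos_iff_degree_pos.1 (Nat.pos_of_ne_zero hdeg)
  have hn : (q.comp (-X)).natDegree = q.natDegree := by simp [natDegree_comp]
  have hd' : 0 < (q.comp (-X)).degree :=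
    natDegree_pos_iff_degree_pos.1 (by rw [hn]; exact Nat.pos_of_ne_zero hdeg)
  have hl' : 0 ≤ (q.comp (-X)).leadingCoeff := by
    rw [leadingCoeff_comp (by simp)]
    simp [heven.neg_one_pow, hlead.le]
  have h₁ := (q.tendsto_atTop_of_leadingCoeff_nonneg hd hlead.le).eventually_gt_atTop 0
  have h₂ := ((q.comp (-X)).tendsto_atTop_of_leadingCoeff_nonneg hd' hl').eventually_gt_atTop 0
  obtain ⟨M, hM⟩ := Filter.eventually_atTop.1 (h₁.and h₂)
  refine ⟨max M 1, by positivity, fun u hu => ?_⟩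
  have hMu : M ≤ |u| := (le_max_left _ _).trans hu
  rcases abs_choice u with h | h
  · rw [h] at hMu
    exact (hM u hMu).1
  · rw [h] at hMu
    simpa using (hM (-u) hMu).2

/-- A product of two real polynomials of odd degree has, away from a bounded set,
the sign of the product of their leading coefficients. -/
theorem Polynomial.exists_forall_le_abs_leadingCoeff_mul_eval_pos {p q : ℝ[X]}
    (hp : Odd p.natDegree) (hq : Odd q.natDegree) :
    ∃ M : ℝ, 0 < M ∧ ∀ u : ℝ, M ≤ |u| →
      0 < p.leadingCoeff * q.leadingCoeff * (p.eval u * q.eval u) := by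
  have hp0 : p ≠ 0 := by rintro rfl; simp at hp
  have hq0 : q ≠ 0 := by rintro rfl; simp at hq
  have hL : p.leadingCoeff * q.leadingCoeff ≠ 0 := by simp [hp0, hq0]
  have hn : (C (p.leadingCoeff * q.leadingCoeff) * (p * q)).natDegree
      = p.natDegree + q.natDegree := by
    rw [natDegree_C_mul hL, natDegree_mul hp0 hq0]
  obtain ⟨M, hM, h⟩ := exists_forall_le_abs_eval_pos
    (q := C (p.leadingCoeff * q.leadingCoeff) * (p * q))
    (by rw [hn]; have := hp.pos; omega) (by rw [hn]; exact hp.add_odd hq)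
    (by rw [leadingCoeff_mul, leadingCoeff_C, leadingCoeff_mul]; exact mul_self_pos.2 hL)
  exact ⟨M, hM, fun u hu => by simpa using h u hu⟩

/-- A real polynomial of odd degree takes opposite signs far to the left and far to the right. -/
theorem Polynomial.exists_forall_le_eval_neg_mul_eval_neg {p : ℝ[X]} (hp : Odd p.natDegree) :
    ∃ M : ℝ, 0 < M ∧ ∀ u : ℝ, M ≤ u → p.eval (-u) * p.eval u < 0 := by
  obtain ⟨M, hM, h⟩ := exists_forall_le_abs_leadingCoeff_mul_eval_pos hp
    (q := X) (by simp)
  refine ⟨M, hM, fun u hu => ?_⟩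
  have hu0 : 0 < u := hM.trans_le hu
  have h₁ := h u (by rwa [abs_of_pos hu0])
  have h₂ := h (-u) (by rwa [abs_neg, abs_of_pos hu0])
  simp only [leadingCoeff_X, mul_one, eval_X] at h₁ h₂
  have h₃ : 0 < p.leadingCoeff * p.eval u := by
    refine pos_of_mul_pos_left (b := u) ?_ hu0.le
    linarith
  have h₄ : p.leadingCoeff * p.eval (-u) < 0 := by
    by_contra! h₅
    nlinarith
  by_contra! h₅
  have := mul_neg_of_neg_of_pos h₄ h₃
  nlinarith [sq_nonneg p.leadingCoeff, mul_nonneg (sq_nonneg p.leadingCoeff) h₅]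

theorem Polynomial.exists_eval_eq_zero_of_odd_natDegree {p : ℝ[X]} (hp : Odd p.natDegree) :
    ∃ u : ℝ, p.eval u = 0 := by
  obtain ⟨M, -, h⟩ := exists_forall_le_eval_neg_mul_eval_neg hp
  have hneg := h M le_rfl
  rcases mul_neg_iff.1 hneg with ⟨h₁, h₂⟩ | ⟨h₁, h₂⟩
  · exact mem_range_of_exists_le_of_exists_ge p.continuous ⟨_, h₂.le⟩ ⟨_, h₁.le⟩
  · exact mem_range_of_exists_le_of_exists_ge p.continuous ⟨_, h₁.le⟩ ⟨_, h₂.le⟩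

/-- A continuous function without zeros on an interval has constant sign there. -/
theorem ContinuousOn.mul_pos_of_forall_ne_zero {f : ℝ → ℝ} {a b : ℝ}
    (hf : ContinuousOn f (Set.uIcc a b)) (h : ∀ u ∈ Set.uIcc a b, f u ≠ 0) :
    0 < f a * f b := by
  by_contra! hle
  have h0 : (0 : ℝ) ∈ Set.uIcc (f a) (f b) := by
    rw [Set.mem_uIcc]
    rcases mul_nonpos_iff.1 hle with h' | h'
    · exact Or.inr ⟨h'.2, h'.1⟩
    · exact Or.inl h'
  obtain ⟨u, hu, hu0⟩ := intermediate_value_uIcc hf h0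
  exact h u hu hu0

/-- The values of an odd degree real polynomial with only one real root have opposite signs
on both sides of that root. -/
theorem Polynomial.eval_mul_eval_neg_of_unique_root {p : ℝ[X]} (hp : Odd p.natDegree) {c : ℝ}
    (hc : ∀ u : ℝ, p.eval u = 0 → u = c) {a b : ℝ} (ha : a < c) (hb : c < b) :
    p.eval a * p.eval b < 0 := by
  obtain ⟨M, -, h⟩ := exists_forall_le_eval_neg_mul_eval_neg hp
  set N := max M (max (-a) b)
  have hN := h N (le_max_left _ _)
  have hNa : -N ≤ a := by
    have : -a ≤ N := (le_max_left _ _).trans (le_max_right _ _)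
    linarith
  have hNb : b ≤ N := (le_max_right _ _).trans (le_max_right _ _)
  have h₁ : 0 < p.eval (-N) * p.eval a :=
    p.continuous.continuousOn.mul_pos_of_forall_ne_zero fun u hu hu0 => by
      rw [Set.uIcc_of_le hNa] at hu
      have := hc u hu0
      linarith [hu.2]
  have h₂ : 0 < p.eval b * p.eval N :=
    p.continuous.continuousOn.mul_pos_of_forall_ne_zero fun u hu hu0 => by
      rw [Set.uIcc_of_le hNb] at hu
      have := hc u hu0
      linarith [hu.1]
  by_contra! h₃
  have h₄ := mul_pos h₁ h₂
  have h₅ := mul_nonpos_of_nonneg_of_nonpos h₃ hN.le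
  linarith

/-- The Wronskian of two polynomials does not vanish if some point is a root of exactly one
of them. -/
theorem Polynomial.wronskian_ne_zero_of_isRoot {p q : ℝ[X]} (hq : q ≠ 0) {c : ℝ}
    (hqc : q.IsRoot c) (hpc : ¬p.IsRoot c) : wronskian p q ≠ 0 := by
  intro hW
  have hp : p ≠ 0 := by rintro rfl; simp at hpc
  have hm : 0 < q.rootMultiplicity c := (rootMultiplicity_pos hq).2 hqc
  have hq' : derivative q ≠ 0 := by
    intro h0
    have := derivative_eq_zero.1 h0
    rw [eq_C_of_natDegree_eq_zero this] at hqc hq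
    simp_all
  have hdvd : (X - C c) ^ q.rootMultiplicity c ∣ p * derivative q := by
    rw [sub_eq_zero.1 (hW : p * derivative q - derivative p * q = 0)]
    exact (pow_rootMultiplicity_dvd q c).mul_left _
  have hle := (le_rootMultiplicity_iff (mul_ne_zero hp hq')).2 hdvd
  rw [rootMultiplicity_mul (mul_ne_zero hp hq'), rootMultiplicity_eq_zero hpc,
    derivative_rootMultiplicity_of_root hqc] at hle
  omega

/-- Between two roots of a member of the pencil spanned by `p` and `q`, on an interval where `p`
does not vanish, there is a root of the Wronskian. -/
theorem Polynomial.exists_wronskian_eval_eq_zero {p q : ℝ[X]} {r a b : ℝ} (hab : a < b)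
    (hp : ∀ u ∈ Set.Icc a b, p.eval u ≠ 0) (ha : (C r * p + q).eval a = 0)
    (hb : (C r * p + q).eval b = 0) : ∃ u ∈ Set.Ioo a b, (wronskian p q).eval u = 0 := by
  have hval : ∀ u ∈ Set.Icc a b, (C r * p + q).eval u = 0 → q.eval u / p.eval u = -r := by
    intro u hu h
    rw [div_eq_iff (hp u hu)]
    simp only [eval_add, eval_mul, eval_C] at h
    linarith
  obtain ⟨u, hu, h⟩ := exists_hasDerivAt_eq_zero (f := fun u => q.eval u / p.eval u) hab
    (q.continuous.continuousOn.div p.continuous.continuousOn hp)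
    ((hval a ⟨le_rfl, hab.le⟩ ha).trans (hval b ⟨hab.le, le_rfl⟩ hb).symm)
    (fun u hu => (q.hasDerivAt u).div (p.hasDerivAt u) (hp u (Set.Ioo_subset_Icc_self hu)))
  refine ⟨u, hu, ?_⟩
  have hpu := hp u (Set.Ioo_subset_Icc_self hu)
  rw [div_eq_zero_iff, or_iff_left (pow_ne_zero 2 hpu)] at h
  simp only [wronskian, eval_sub, eval_mul]
  linarith

theorem stmt_9 (x y : Polynomial ℝ)
    (hcomax : ¬∃ u : ℝ, x.eval u = 0 ∧ y.eval u = 0)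
    (hxodd : Odd x.natDegree) (hyodd : Odd y.natDegree)
    (hdeg : y.natDegree < x.natDegree)
    (hyroot : ∃! u : ℝ, y.eval u = 0)
    (hx12 : ∃ x₁ x₂ : ℝ, x.eval x₁ = 0 ∧ x.eval x₂ = 0 ∧ y.eval x₁ * y.eval x₂ < 0) :
    ∃ r : ℝ, r ≠ 0 ∧ ∃! u : ℝ, (C r * x + y).eval u = 0 := by
  obtain ⟨c, hc, huniq⟩ := hyroot
  have hxc : x.eval c ≠ 0 := fun h => hcomax ⟨c, h, hc⟩
  have hx0 : x ≠ 0 := by rintro rfl; simp at hxc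
  have hy0 : y ≠ 0 := by rintro rfl; simp at hyodd
  have hW : wronskian x y ≠ 0 := wronskian_ne_zero_of_isRoot hy0 hc hxc
  obtain ⟨δ, hδ, hball⟩ : ∃ δ > 0, ∀ u : ℝ, |u - c| < δ →
      x.eval u ≠ 0 ∧ (u ≠ c → (wronskian x y).eval u ≠ 0) := by
    have h₁ := x.continuous.continuousAt.eventually_ne hxc
    have h₂ : ∀ᶠ u in nhds c, u ≠ c → (wronskian x y).eval u ≠ 0 := by
      have hfin : ({u | (wronskian x y).IsRoot u} \ {c}).Finite :=
        (finite_setOfPred_isRoot hW).subset Set.sdiff_subset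
      filter_upwards [hfin.isClosed.isOpen_compl.mem_nhds (by simp : c ∈ _)] with u hu huc h0
      exact hu ⟨h0, huc⟩
    obtain ⟨δ, hδ, h⟩ := Metric.eventually_nhds_iff.1 (h₁.and h₂)
    exact ⟨δ, hδ, fun u hu => h (by rwa [Real.dist_eq])⟩
  obtain ⟨M, -, hfar⟩ := exists_forall_le_abs_leadingCoeff_mul_eval_pos hxodd hyodd
  set L := x.leadingCoeff * y.leadingCoeff
  have hL : L ≠ 0 := by simp [L, hx0, hy0]
  -- On the compact set of points neither near the root of `y` nor far away,
  -- `y` dominates small multiples of `x`.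
  obtain ⟨s, hs, hmid⟩ : ∃ s > 0, ∀ u : ℝ, |u| ≤ M → δ ≤ |u - c| →
      s * |L * x.eval u| < |y.eval u| := by
    have hK : IsCompact (Set.Icc (-M) M ∩ {u | δ ≤ |u - c|}) :=
      isCompact_Icc.inter_right (isClosed_le continuous_const (by fun_prop))
    have hne : ∀ u ∈ Set.Icc (-M) M ∩ {u | δ ≤ |u - c|}, y.eval u ≠ 0 := by
      rintro u ⟨-, hu⟩ h0
      rw [huniq u h0] at hu
      simp only [Set.mem_ofPred_eq, sub_self, abs_zero] at hu
      linarith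
    obtain ⟨B, hB⟩ := hK.exists_bound_of_continuousOn
      (f := fun u => L * x.eval u / y.eval u)
      ((continuous_const.mul x.continuous).continuousOn.div y.continuous.continuousOn hne)
    refine ⟨(|B| + 1)⁻¹, by positivity, fun u hu hu' => ?_⟩
    have hmem : u ∈ Set.Icc (-M) M ∩ {u | δ ≤ |u - c|} := ⟨abs_le.1 hu, hu'⟩
    have hy : 0 < |y.eval u| := abs_pos.2 (hne u hmem)
    have h := hB u hmem
    rw [Real.norm_eq_abs, abs_div, div_le_iff₀ hy] at h
    rw [inv_mul_lt_iff₀ (by positivity)]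
    nlinarith [le_abs_self B]
  have hr : s * L ≠ 0 := mul_ne_zero hs.ne' hL
  have hnear : ∀ u : ℝ, (C (s * L) * x + y).eval u = 0 → |u - c| < δ := by
    intro u hu
    simp only [eval_add, eval_mul, eval_C] at hu
    by_contra! hδu
    have hyu : y.eval u = -(s * (L * x.eval u)) := by linarith
    rcases le_total |u| M with hM | hM
    · have h := hmid u hM hδu
      rw [hyu, abs_neg, abs_mul s, abs_of_pos hs] at h
      exact h.false
    · have h := hfar u hM
      rw [hyu] at h
      nlinarith [mul_nonneg hs.le (sq_nonneg (L * x.eval u))]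
  have hodd : Odd (C (s * L) * x + y).natDegree := by
    have h := natDegree_C_mul (p := x) hr
    rwa [natDegree_add_eq_left_of_natDegree_lt (by rwa [h]), h]
  have hinj : ∀ a b : ℝ, a < b → (C (s * L) * x + y).eval a = 0 →
      (C (s * L) * x + y).eval b ≠ 0 := by
    intro a b hab ha hb
    have hda := abs_lt.1 (hnear a ha)
    have hdb := abs_lt.1 (hnear b hb)
    have hxne : ∀ u ∈ Set.Icc a b, x.eval u ≠ 0 := fun u hu =>
      (hball u (abs_lt.2 ⟨by linarith [hu.1], by linarith [hu.2]⟩)).1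
    obtain ⟨u, hu, hu0⟩ := exists_wronskian_eval_eq_zero hab hxne ha hb
    have huc : u = c := by
      by_contra h
      exact (hball u (abs_lt.2 ⟨by linarith [hu.1], by linarith [hu.2]⟩)).2 h hu0
    subst huc
    have hyab := eval_mul_eval_neg_of_unique_root hyodd huniq hu.1 hu.2
    have hxab : 0 < x.eval a * x.eval b :=
      x.continuous.continuousOn.mul_pos_of_forall_ne_zero (by rwa [Set.uIcc_of_le hab.le])
    simp only [eval_add, eval_mul, eval_C] at ha hb
    rw [eq_neg_of_add_eq_zero_right ha, eq_neg_of_add_eq_zero_right hb] at hyab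
    nlinarith [mul_nonneg (sq_nonneg (s * L)) hxab.le]
  obtain ⟨u, hu⟩ := exists_eval_eq_zero_of_odd_natDegree hodd
  refine ⟨s * L, hr, u, hu, fun v hv => ?_⟩
  rcases lt_trichotomy v u with h | h | h
  · exact (hinj v u h hv hu).elim
  · exact h
  · exact (hinj u v h hu hv).elim
end
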